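/- arXiv:1304.2448 — 3 statements merged into one kernel-verified Lean document; each statement's English description precedes it below -/
import Mathlib

section
/- Let M be a simple binary matroid of rank r ≥ 6 with no AG(3,2)-minor such that |M| = (r+1 choose 2). Then M is isomorphic to the graphic matroid M(K_{r+1}) of the complete graph on r+1 vertices. -/
open Matroid Set

variable {α : Type*}

/-- Deletion of a set of elements from a matroid. -/
def Matroid.del (M : Matroid α) (D : Set α) : Matroid α := M ↾ (M.E \ D)

/-- Contraction of a set of elements in a matroid, defined by duality. -/
def Matroid.con (M : Matroid α) (C : Set α) : Matroid α := ((M✶).del C)✶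

/-- `N` is a minor of `M` if it is obtained from `M` by a contraction followed by a deletion. -/
def Matroid.IsMinorOf (N M : Matroid α) : Prop := ∃ C D : Set α, N = (M.con C).del D

/-- `C` is a circuit of `M`: a dependent set all of whose proper subsets are independent. -/
def Matroid.IsCircuitSet (M : Matroid α) (C : Set α) : Prop :=
  M.Dep C ∧ ∀ D ⊂ C, M.Indep D

/-- A matroid is simple if it has no circuits of size one or two, equivalently every
one- or two-element subset of the ground set is independent. -/
def Matroid.IsSimpleM (M : Matroid α) : Prop := ∀ e ∈ M.E, ∀ f ∈ M.E, M.Indep {e, f}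

/-- The rank of a set `X` in a matroid `M`: the supremum of the sizes of independent
subsets of `X`. -/
noncomputable def Matroid.rks (M : Matroid α) (X : Set α) : ℕ :=
  sSup {n : ℕ | ∃ I ⊆ X, M.Indep I ∧ I.ncard = n}

/-- The rank of a matroid. -/
noncomputable def Matroid.rkM (M : Matroid α) : ℕ := M.rks M.E

/-- `M` is represented over the field `F` by the vector assignment `φ`:
a subset of the ground set is independent iff `φ` is linearly independent on it. -/
def Matroid.IsRepBy (M : Matroid α) (F : Type*) [Field F] {W : Type*} [AddCommGroup W]
    [Module F W] (φ : α → W) : Prop :=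
  ∀ I ⊆ M.E, (M.Indep I ↔ LinearIndependent F (I.restrict φ))

/-- `M` is representable over the field `F`. -/
def Matroid.IsRepOver (M : Matroid α) (F : Type) [Field F] : Prop :=
  ∃ (n : ℕ) (φ : α → (Fin n → F)), M.IsRepBy F φ

/-- A binary matroid is one representable over the two-element field `GF(2)`. -/
def Matroid.IsBinaryM (M : Matroid α) : Prop := M.IsRepOver (ZMod 2)

/-- A regular matroid is one representable over every field. -/
def Matroid.IsRegularM (M : Matroid α) : Prop := ∀ (F : Type) [Field F], M.IsRepOver F

/-- `M` is isomorphic to the binary vector matroid on the set of vectors `V`: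
there is a representation of `M` over `GF(2)` mapping the ground set bijectively to `V`. -/
def Matroid.IsBinaryIsoTo (M : Matroid α) {W : Type*} [AddCommGroup W] [Module (ZMod 2) W]
    (V : Set W) : Prop :=
  ∃ φ : α → W, M.IsRepBy (ZMod 2) φ ∧ Set.BijOn φ M.E V

/-- The eight points of the binary affine cube `AG(3,2)`: the vectors `(1, x)` in `GF(2)⁴`. -/
def agVecs : Set (Fin 4 → ZMod 2) := {x | x 0 = 1}

/-- `M` has a minor isomorphic to `AG(3,2)`. -/
def Matroid.HasAGMinor (M : Matroid α) : Prop :=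
  ∃ N : Matroid α, N.IsMinorOf M ∧ N.IsBinaryIsoTo agVecs

/-- The seven points of the Fano plane `F₇`: the nonzero vectors of `GF(2)³`. -/
def fanoVecs : Set (Fin 3 → ZMod 2) := {x | x ≠ 0}

/-- The vectors `eᵢ + eⱼ` (`i ≠ j`) representing the graphic matroid `M(K_n)`. -/
def kVecs (n : ℕ) : Set (Fin n → ZMod 2) :=
  {x | ∃ i j : Fin n, i ≠ j ∧ x = Pi.single i 1 + Pi.single j 1}

/-- `ℓ` is a line (3-element circuit) of `M` through `x`. -/
def Matroid.IsLineThru (M : Matroid α) (x : α) (ℓ : Set α) : Prop :=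
  M.IsCircuitSet ℓ ∧ ℓ.ncard = 3 ∧ x ∈ ℓ

/-- A matroid is connected if it is nonempty and every two distinct elements of the
ground set lie in a common circuit. -/
def Matroid.IsConnectedM (M : Matroid α) : Prop :=
  M.E.Nonempty ∧ ∀ e ∈ M.E, ∀ f ∈ M.E, e ≠ f →
    ∃ C, M.IsCircuitSet C ∧ e ∈ C ∧ f ∈ C

/-- A matroid is 3-connected if it is connected and has no 2-separation, i.e. no partition
`(A, B)` of the ground set with `|A| ≥ 2`, `|B| ≥ 2` and `r(A) + r(B) - r(M) ≤ 1`. -/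
def Matroid.IsThreeConnected (M : Matroid α) : Prop :=
  M.IsConnectedM ∧ ¬ ∃ A B : Set α, A ∪ B = M.E ∧ Disjoint A B ∧
    2 ≤ A.ncard ∧ 2 ≤ B.ncard ∧ M.rks A + M.rks B ≤ M.rkM + 1


namespace AGP
universe u
set_option linter.unusedSectionVars false
open Submodule Module

variable {V W : Type u} [AddCommGroup V] [Module (ZMod 2) V] [AddCommGroup W] [Module (ZMod 2) W]

/-- vector version of having an `AG(3,2)`-minor -/
def HasAG (S : Set V) : Prop :=
  ∃ (C : Set V) (a b c d : V), C ⊆ S ∧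
    (∀ α β γ δ : ZMod 2, α • a + β • b + γ • c + δ • d ∈ span (ZMod 2) C →
      α = 0 ∧ β = 0 ∧ γ = 0 ∧ δ = 0) ∧
    ∀ β γ δ : ZMod 2, ∃ s ∈ S, s + (a + β • b + γ • c + δ • d) ∈ span (ZMod 2) C

theorem z2 (c : ZMod 2) : c = 0 ∨ c = 1 := by
  revert c; decide

theorem dbl (v : V) : v + v = 0 := ZModModule.add_self v

theorem add_eq_zero_iff' {u v : V} : u + v = 0 ↔ u = v := by
  rw [add_eq_zero_iff_eq_neg, ZModModule.neg_eq_self]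

theorem HasAG.mono {S S' : Set V} (h : S ⊆ S') (hS : HasAG S) : HasAG S' := by
  obtain ⟨C, a, b, c, d, hC, hi, hm⟩ := hS
  refine ⟨C, a, b, c, d, hC.trans h, hi, fun β γ δ => ?_⟩
  obtain ⟨s, hs, h'⟩ := hm β γ δ
  exact ⟨s, h hs, h'⟩

theorem HasAG.map_inj {S : Set V} (f : V →ₗ[ZMod 2] W) (hf : Function.Injective f)
    (hS : HasAG S) : HasAG (f '' S) := by
  obtain ⟨C, a, b, c, d, hC, hi, hm⟩ := hS
  refine ⟨f '' C, f a, f b, f c, f d, image_mono hC, fun α β γ δ h => ?_, fun β γ δ => ?_⟩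
  · rw [span_image] at h
    obtain ⟨v, hv, hv'⟩ := h
    apply hi
    have : α • a + β • b + γ • c + δ • d = v := by
      apply hf
      rw [hv']; simp
    rw [this]; exact hv
  · obtain ⟨s, hs, h'⟩ := hm β γ δ
    refine ⟨f s, ⟨s, hs, rfl⟩, ?_⟩
    rw [span_image]
    exact ⟨_, h', by simp⟩

/-- `f` is the contraction of the vector `x`. -/
structure IsCon (f : V →ₗ[ZMod 2] W) (x : V) : Prop where
  surj : Function.Surjective f
  ker : ∀ v, f v = 0 ↔ v = 0 ∨ v = x
  ne : x ≠ 0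

theorem isCon_mkQ (x : V) (hx : x ≠ 0) : IsCon (span (ZMod 2) {x}).mkQ x := by
  refine ⟨mkQ_surjective _, fun v => ?_, hx⟩
  rw [mkQ_apply, Quotient.mk_eq_zero, mem_span_singleton]
  constructor
  · rintro ⟨a, rfl⟩
    rcases z2 a with rfl | rfl <;> simp
  · rintro (rfl | rfl)
    · exact ⟨0, by simp⟩
    · exact ⟨1, by simp⟩

namespace IsCon
variable {f : V →ₗ[ZMod 2] W} {x : V}

theorem map_x (hf : IsCon f x) : f x = 0 := (hf.ker x).2 (Or.inr rfl)

theorem eq_iff (hf : IsCon f x) {u v : V} : f u = f v ↔ u = v ∨ u = v + x := by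
  rw [← add_eq_zero_iff', ← map_add, hf.ker, add_eq_zero_iff']
  apply or_congr Iff.rfl
  constructor
  · rintro h; rw [← h, add_comm u v, ← add_assoc, dbl, zero_add]
  · rintro h; rw [h, add_right_comm, dbl, zero_add]

theorem ker_eq (hf : IsCon f x) : LinearMap.ker f = span (ZMod 2) {x} := by
  ext v
  rw [LinearMap.mem_ker, hf.ker, mem_span_singleton]
  constructor
  · rintro (rfl | rfl)
    · exact ⟨0, by simp⟩
    · exact ⟨1, by simp⟩
  · rintro ⟨a, rfl⟩
    rcases z2 a with rfl | rfl <;> simp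

theorem hasAG (hf : IsCon f x) {S : Set V} (hx : x ∈ S) (h : HasAG (f '' S)) : HasAG S := by
  obtain ⟨C, a, b, c, d, hC, hi, hm⟩ := h
  obtain ⟨a, rfl⟩ := hf.surj a
  obtain ⟨b, rfl⟩ := hf.surj b
  obtain ⟨c, rfl⟩ := hf.surj c
  obtain ⟨d, rfl⟩ := hf.surj d
  let C' : Set V := {s | s ∈ S ∧ (f s ∈ C ∨ s = x)}
  have key : ∀ v, v ∈ span (ZMod 2) C' ↔ f v ∈ span (ZMod 2) C := by
    intro v
    constructor
    · intro h
      have : span (ZMod 2) C' ≤ (span (ZMod 2) C).comap f := by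
        rw [span_le]
        rintro s ⟨_, h | h⟩
        · exact subset_span h
        · simp [h, hf.map_x]
      exact this h
    · intro h
      have h1 : span (ZMod 2) C ≤ (span (ZMod 2) C').map f := by
        rw [span_le]
        intro p hp
        obtain ⟨s, hs, rfl⟩ := hC hp
        exact ⟨s, subset_span ⟨hs, Or.inl hp⟩, rfl⟩
      obtain ⟨u, hu, huv⟩ := h1 h
      rcases hf.eq_iff.1 huv.symm with rfl | rfl
      · exact hu
      · exact add_mem hu (subset_span ⟨hx, Or.inr rfl⟩)
  refine ⟨C', a, b, c, d, fun s hs => hs.1, fun α β γ δ h => ?_, fun β γ δ => ?_⟩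
  · rw [key] at h
    apply hi
    simpa using h
  · obtain ⟨s, ⟨s, hs, rfl⟩, h'⟩ := hm β γ δ
    refine ⟨s, hs, ?_⟩
    rw [key]
    simpa using h'

end IsCon

/-- rank of a finite set of vectors -/
noncomputable def rk (S : Finset V) : ℕ := finrank (ZMod 2) (span (ZMod 2) (S : Set V))

theorem rk_mono {S T : Finset V} (h : S ⊆ T) : rk S ≤ rk T :=
  Submodule.finrank_mono (span_mono (by exact_mod_cast h))

theorem le_rk {S : Finset V} (F : Submodule (ZMod 2) V)
    (hF : F ≤ span (ZMod 2) (S : Set V)) : finrank (ZMod 2) F ≤ rk S :=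
  Submodule.finrank_mono hF

open Classical in
theorem rk_submod (A B : Finset V) : rk (A ∪ B) + rk (A ∩ B) ≤ rk A + rk B := by
  unfold rk
  rw [← Submodule.finrank_sup_add_finrank_inf_eq (span (ZMod 2) (A : Set V)),
    Finset.coe_union, span_union]
  have : finrank (ZMod 2) (span (ZMod 2) ((A ∩ B : Finset V) : Set V)) ≤
      finrank (ZMod 2) ↥(span (ZMod 2) (A : Set V) ⊓ span (ZMod 2) (B : Set V)) := by
    apply Submodule.finrank_mono
    rw [Finset.coe_inter]
    exact le_inf (span_mono inter_subset_left) (span_mono inter_subset_right)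
  omega

open Classical in
/-- simplified contraction -/
noncomputable def con (S : Finset V) (f : V →ₗ[ZMod 2] W) : Finset W := (S.image f).erase 0

theorem zero_notMem_con (S : Finset V) (f : V →ₗ[ZMod 2] W) : (0 : W) ∉ con S f := by
  simp [con]

theorem mem_con {S : Finset V} {f : V →ₗ[ZMod 2] W} {p : W} :
    p ∈ con S f ↔ p ≠ 0 ∧ ∃ s ∈ S, f s = p := by
  simp [con]

theorem span_con (S : Finset V) (f : V →ₗ[ZMod 2] W) :
    span (ZMod 2) (con S f : Set W) = (span (ZMod 2) (S : Set V)).map f := by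
  classical
  rw [con, Finset.coe_erase, span_sdiff_singleton_zero, Finset.coe_image, span_image]

theorem IsCon.finrank_map {f : V →ₗ[ZMod 2] W} {x : V} (hf : IsCon f x) (P : Submodule (ZMod 2) V)
    [FiniteDimensional (ZMod 2) P] (hx : x ∈ P) :
    finrank (ZMod 2) (P.map f) + 1 = finrank (ZMod 2) P := by
  have h := LinearMap.finrank_range_add_finrank_ker (f.domRestrict P)
  rw [LinearMap.range_domRestrict] at h
  rw [← h]
  congr 1
  have : LinearMap.ker (f.domRestrict P) = span (ZMod 2) {⟨x, hx⟩} := by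
    ext ⟨v, hv⟩
    have := SetLike.ext_iff.1 hf.ker_eq v
    rw [LinearMap.mem_ker, mem_span_singleton] at this
    rw [LinearMap.mem_ker, LinearMap.domRestrict_apply, mem_span_singleton, this]
    simp [Subtype.ext_iff]
  rw [this, finrank_span_singleton]
  intro h
  exact hf.ne (congrArg Subtype.val h)

theorem rk_con {S : Finset V} {f : V →ₗ[ZMod 2] W} {x : V} (hf : IsCon f x) (hx : x ∈ S) :
    rk (con S f) + 1 = rk S := by
  unfold rk
  rw [span_con]
  exact hf.finrank_map _ (subset_span hx)

theorem con_AG {S : Finset V} {f : V →ₗ[ZMod 2] W} {x : V} (hf : IsCon f x) (hx : x ∈ S)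
    (h : ¬ HasAG (S : Set V)) : ¬ HasAG (con S f : Set W) := by
  classical
  intro h'
  apply h
  apply hf.hasAG hx
  apply h'.mono
  intro p hp
  rw [Finset.mem_coe, mem_con] at hp
  exact hp.2

open Classical in
/-- the vectors on a line with `x` -/
noncomputable def dd (S : Finset V) (x : V) : Finset V := S.filter (fun u => u + x ∈ S)

theorem mem_dd {S : Finset V} {x u : V} : u ∈ dd S x ↔ u ∈ S ∧ u + x ∈ S := by
  simp [dd]

open Classical in
noncomputable def tt (S : Finset V) (x : V) (f : V →ₗ[ZMod 2] W) : Finset W := (dd S x).image f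

theorem mem_tt {S : Finset V} {x : V} {f : V →ₗ[ZMod 2] W} {p : W} :
    p ∈ tt S x f ↔ ∃ s, s ∈ S ∧ s + x ∈ S ∧ f s = p := by
  simp [tt, mem_dd, and_assoc]

theorem card_dd {S : Finset V} {f : V →ₗ[ZMod 2] W} {x : V} (hf : IsCon f x) :
    (dd S x).card = 2 * (tt S x f).card := by
  classical
  rw [Finset.card_eq_sum_card_image f (dd S x), mul_comm, ← smul_eq_mul, ← Finset.sum_const]
  apply Finset.sum_congr rfl
  intro p hp
  obtain ⟨s, hs, hs', rfl⟩ := mem_tt.1 hp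
  rw [Finset.card_eq_two]
  refine ⟨s, s + x, ?_, ?_⟩
  · intro h; exact hf.ne (by simpa using h)
  · ext u
    simp only [Finset.mem_filter, mem_dd, Finset.mem_insert, Finset.mem_singleton, hf.eq_iff]
    constructor
    · rintro ⟨_, h⟩; exact h
    · rintro (rfl | rfl)
      · exact ⟨⟨hs, hs'⟩, Or.inl rfl⟩
      · refine ⟨⟨hs', ?_⟩, Or.inr rfl⟩
        rw [add_assoc, dbl, add_zero]; exact hs

theorem card_con {S : Finset V} {f : V →ₗ[ZMod 2] W} {x : V} (hf : IsCon f x) (h0 : (0 : V) ∉ S)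
    (hx : x ∈ S) : S.card = 1 + (con S f).card + (tt S x f).card := by
  classical
  have h1 : (S.erase x).card = ∑ p ∈ con S f, (1 + if p ∈ tt S x f then 1 else 0) := by
    rw [Finset.card_eq_sum_card_fiberwise (f := f) (t := con S f)]
    · apply Finset.sum_congr rfl
      intro p hp
      obtain ⟨hp0, s, hs, rfl⟩ := mem_con.1 hp
      split_ifs with h
      · obtain ⟨s', hs', hs'', h⟩ := mem_tt.1 h
        rw [Finset.card_eq_two]
        refine ⟨s', s' + x, ?_, ?_⟩
        · intro h; exact hf.ne (by simpa using h)
        · ext u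
          simp only [Finset.mem_filter, Finset.mem_erase, Finset.mem_insert, Finset.mem_singleton]
          rw [← h, hf.eq_iff]
          constructor
          · rintro ⟨_, h⟩; exact h
          · rintro (rfl | rfl)
            · refine ⟨⟨?_, hs'⟩, Or.inl rfl⟩
              rintro rfl
              apply h0; simpa [dbl] using hs''
            · refine ⟨⟨?_, hs''⟩, Or.inr rfl⟩
              intro h
              apply h0
              have : s' = 0 := by simpa using h
              rwa [← this]
      · rw [add_zero, Finset.card_eq_one]
        refine ⟨s, ?_⟩
        ext u
        simp only [Finset.mem_filter, Finset.mem_erase, Finset.mem_singleton]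
        constructor
        · rintro ⟨⟨_, hu⟩, h'⟩
          rcases hf.eq_iff.1 h' with rfl | rfl
          · rfl
          · exact absurd (mem_tt.2 ⟨s, hs, hu, rfl⟩) h
        · rintro rfl
          refine ⟨⟨?_, hs⟩, rfl⟩
          rintro rfl
          exact hp0 hf.map_x
    · intro s hs
      simp only [Finset.coe_erase, Set.mem_sdiff, Finset.mem_coe, Set.mem_singleton_iff] at hs
      rw [Finset.mem_coe, mem_con]
      refine ⟨?_, s, hs.1, rfl⟩
      rw [Ne, hf.ker]
      rintro (rfl | h)
      · exact h0 hs.1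
      · exact hs.2 h
  have h2 : tt S x f ⊆ con S f := by
    intro p hp
    obtain ⟨s, hs, hs', rfl⟩ := mem_tt.1 hp
    rw [mem_con]
    refine ⟨?_, s, hs, rfl⟩
    rw [Ne, hf.ker]
    rintro (rfl | rfl)
    · exact h0 hs
    · apply h0; simpa [dbl] using hs'
  rw [Finset.sum_add_distrib, ← Finset.sum_filter] at h1
  simp only [Finset.sum_const, smul_eq_mul, mul_one] at h1
  rw [Finset.filter_mem_eq_inter, Finset.inter_eq_right.2 h2] at h1
  have := Finset.card_erase_add_one hx
  omega

theorem tt_sub_con {S : Finset V} {f : V →ₗ[ZMod 2] W} {x : V} (hf : IsCon f x) (h0 : (0 : V) ∉ S) :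
    tt S x f ⊆ con S f := by
    intro p hp
    obtain ⟨s, hs, hs', rfl⟩ := mem_tt.1 hp
    rw [mem_con]
    refine ⟨?_, s, hs, rfl⟩
    rw [Ne, hf.ker]
    rintro (rfl | rfl)
    · exact h0 hs
    · apply h0; simpa [dbl] using hs'

end AGP

namespace AGP
universe u
set_option linter.unusedSectionVars false
open Submodule Module

variable {V W : Type u} [AddCommGroup V] [Module (ZMod 2) V] [AddCommGroup W] [Module (ZMod 2) W]

theorem quad {f : V →ₗ[ZMod 2] W} {x : V} (hf : IsCon f x) {S : Set V} {ι : Type u}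
    (b : Basis ι (ZMod 2) W) (η : ι → V) (hη : ∀ i, f (η i) = b i) (I : Finset ι)
    (hI : 3 ≤ I.card) (hIS : ∀ i ∈ I, η i ∈ S ∧ η i + x ∈ S) (J : Set ι)
    (hJ : ∀ j ∈ J, j ∉ I ∧ η j ∈ S) (w w' : V) (hw : w ∈ S) (hw' : w' ∈ S)
    (hfw : f w = ∑ i ∈ I, b i) (hww : w + w' + x ∈ span (ZMod 2) (η '' J)) : HasAG S := by
  classical
  obtain ⟨i, hi, j, hj, k, hk, hij, hik, hjk⟩ := Finset.two_lt_card.1 (show 2 < I.card by omega)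
  set I' : Finset ι := ((I.erase i).erase j).erase k with hI'
  have hsplit : ∀ {X : Type u} [AddCommGroup X] (g : ι → X),
      ∑ t ∈ I, g t = g i + (g j + (g k + ∑ t ∈ I', g t)) := by
    intro X _ g
    rw [Finset.add_sum_erase _ _ (by simp [hk, hik.symm, hjk.symm]),
      Finset.add_sum_erase _ _ (by simp [hj, hij.symm]), Finset.add_sum_erase _ _ hi]
  set C : Set V := η '' ((I' : Set ι) ∪ J) with hC
  let σ : W →ₗ[ZMod 2] V := b.constr (ZMod 2) η
  have hσ : ∀ i, σ (b i) = η i := fun i => b.constr_basis _ _ _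
  have hCσ : ∀ v ∈ span (ZMod 2) C, σ (f v) = v := by
    intro v hv
    induction hv using span_induction with
    | mem v hv => obtain ⟨t, _, rfl⟩ := hv; rw [hη, hσ]
    | zero => simp
    | add u v _ _ hu hv => simp [hu, hv]
    | smul a v _ hv => simp [hv]
  have hcoord : ∀ t, t ∉ I' → t ∉ J → ∀ v ∈ span (ZMod 2) C, b.repr (f v) t = 0 := by
    intro t ht ht' v hv
    induction hv using span_induction with
    | mem v hv =>
      obtain ⟨s, hs, rfl⟩ := hv
      rw [hη, Basis.repr_self, Finsupp.single_apply, if_neg]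
      rintro rfl
      rcases hs with hs | hs
      · exact ht hs
      · exact ht' hs
    | zero => simp
    | add u v _ _ hu hv => simp [hu, hv]
    | smul a v _ hv => simp [hv]
  have hsub : C ⊆ S := by
    rintro _ ⟨t, ht | ht, rfl⟩
    · rw [Finset.mem_coe] at ht
      exact (hIS t (by simp only [hI', Finset.mem_erase] at ht; exact ht.2.2.2)).1
    · exact (hJ t ht).2
  refine ⟨C, η i, x, η i + η j, η i + η k, hsub, ?_, ?_⟩
  · intro α β γ δ h
    have e : ∀ t, b.repr (f (α • η i + β • x + γ • (η i + η j) + δ • (η i + η k))) t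
        = α * (Finsupp.single i (1 : ZMod 2)) t
          + γ * ((Finsupp.single i (1 : ZMod 2)) t + (Finsupp.single j (1 : ZMod 2)) t)
          + δ * ((Finsupp.single i (1 : ZMod 2)) t + (Finsupp.single k (1 : ZMod 2)) t) := by
      intro t
      simp [hη, hf.map_x, Finsupp.single_apply, mul_add]
    have ei := hcoord i (by simp [hI']) (fun h => (hJ i h).1 hi) _ h
    have ej := hcoord j (by simp [hI']) (fun h => (hJ j h).1 hj) _ h
    have ek := hcoord k (by simp [hI']) (fun h => (hJ k h).1 hk) _ h
    rw [e] at ei ej ek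
    simp [hij, hik, hjk, hij.symm, hik.symm, hjk.symm] at ei ej ek
    subst ej ek
    simp at ei
    subst ei
    have := hCσ _ h
    simp [hf.map_x] at this
    refine ⟨rfl, ?_, rfl, rfl⟩
    rcases z2 β with h | h
    · exact h
    · subst h
      exact absurd (by simpa using this.symm) hf.ne
  · have hwx : ∃ c : ZMod 2, w + (η i + η j + η k + c • x) ∈ span (ZMod 2) C := by
      have h1 : f (w + (η i + η j + η k)) = f (∑ t ∈ I', η t) := by
        rw [map_add, hfw, hsplit, map_add, map_add, hη, hη, hη, map_sum]
        simp only [hη]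
        have := dbl (b i); have := dbl (b j); have := dbl (b k)
        linear_combination (norm := module) dbl (b i) + dbl (b j) + dbl (b k)
      have h2 : ∑ t ∈ I', η t ∈ span (ZMod 2) C :=
        sum_mem fun t ht => subset_span ⟨t, Or.inl ht, rfl⟩
      rcases hf.eq_iff.1 h1 with h | h
      · exact ⟨0, by rw [zero_smul, add_zero, h]; exact h2⟩
      · refine ⟨1, ?_⟩
        have : w + (η i + η j + η k + (1 : ZMod 2) • x) = ∑ t ∈ I', η t := by
          rw [one_smul, ← add_assoc, h, add_assoc, dbl, add_zero]
        rw [this]; exact h2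
    have hww' : w + w' + x ∈ span (ZMod 2) C :=
      span_mono (image_mono subset_union_right) hww
    have hwx' : ∀ c : ZMod 2, ∃ s ∈ S, s + (η i + η j + η k + c • x) ∈ span (ZMod 2) C := by
      obtain ⟨c, hc⟩ := hwx
      intro c'
      by_cases h : c' = c
      · subst h; exact ⟨w, hw, hc⟩
      · have : c' = c + 1 := by clear hc; revert h; revert c c'; decide
        subst this
        refine ⟨w', hw', ?_⟩
        convert add_mem hc hww' using 1
        rw [add_smul, one_smul]
        linear_combination (norm := module) -dbl w
    intro β γ δ
    have hβ : ∀ t ∈ I, ∃ s ∈ S, s = η t + β • x := by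
      intro t ht
      rcases z2 β with rfl | rfl
      · exact ⟨η t, (hIS t ht).1, by simp⟩
      · exact ⟨_, (hIS t ht).2, by simp⟩
    rcases z2 γ with rfl | rfl <;> rcases z2 δ with rfl | rfl
    · obtain ⟨s, hs, rfl⟩ := hβ i hi
      exact ⟨_, hs, by simp [dbl]⟩
    · obtain ⟨s, hs, rfl⟩ := hβ k hk
      refine ⟨_, hs, ?_⟩
      convert zero_mem (span (ZMod 2) C) using 1
      linear_combination (norm := module) dbl (η k) + dbl (β • x) + dbl (η i)
    · obtain ⟨s, hs, rfl⟩ := hβ j hj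
      refine ⟨_, hs, ?_⟩
      convert zero_mem (span (ZMod 2) C) using 1
      linear_combination (norm := module) dbl (η j) + dbl (β • x) + dbl (η i)
    · obtain ⟨s, hs, h⟩ := hwx' β
      refine ⟨s, hs, ?_⟩
      convert h using 1
      linear_combination (norm := module) dbl (η i)

/-- all nonzero vectors of the plane `F` are in `S` -/
def IsFano (S : Finset V) (F : Submodule (ZMod 2) V) : Prop :=
  finrank (ZMod 2) F = 3 ∧ ∀ v ∈ F, v ≠ 0 → v ∈ S

theorem repr_sum {ι : Type u} (b : Basis ι (ZMod 2) W) (p : W) :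
    p = ∑ i ∈ (b.repr p).support, b i := by
  conv_lhs => rw [← b.linearCombination_repr p]
  rw [Finsupp.linearCombination_apply, Finsupp.sum]
  apply Finset.sum_congr rfl
  intro i hi
  rcases z2 (b.repr p i) with h | h
  · exact absurd h (Finsupp.mem_support_iff.1 hi)
  · rw [h, one_smul]

theorem tt_indep {S : Finset V} {f : V →ₗ[ZMod 2] W} {x : V} (hf : IsCon f x) (h0 : (0 : V) ∉ S)
    (hAG : ¬ HasAG (S : Set V))
    (hnF : ∀ p ∈ tt S x f, ∀ q ∈ tt S x f, p ≠ q → p + q ∉ tt S x f) :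
    LinearIndepOn (ZMod 2) id (tt S x f : Set W) := by
  classical
  obtain ⟨B, hBt, hBs, hBi⟩ := exists_linearIndependent (ZMod 2) (tt S x f : Set W)
  have hBi : LinearIndepOn (ZMod 2) id B := hBi
  suffices h : (tt S x f : Set W) ⊆ B by
    rw [← hBt.antisymm h]; exact hBi
  intro p hp
  by_contra hpB
  let b := Basis.extend hBi
  have hb : ∀ i, b i = (i : W) := fun i => Basis.extend_apply_self hBi i
  have hex : ∀ i : hBi.extend (subset_univ B), ∃ v : V, f v = b i ∧ ((i : W) ∈ B → v ∈ S ∧ v + x ∈ S) := by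
    intro i
    by_cases h : (i : W) ∈ B
    · obtain ⟨s, hs, hs', h'⟩ := mem_tt.1 (hBt h)
      exact ⟨s, by rw [hb, h'], fun _ => ⟨hs, hs'⟩⟩
    · obtain ⟨v, hv⟩ := hf.surj (b i)
      exact ⟨v, hv, fun h' => absurd h' h⟩
  choose η hη hηS using hex
  set I := (b.repr p).support with hI
  have hIB : ∀ i ∈ I, (i : W) ∈ B := by
    have hps : p ∈ span (ZMod 2) (b '' {i | (i : W) ∈ B}) := by
      have : b '' {i | (i : W) ∈ B} = B := by
        ext q
        simp only [mem_image, mem_ofPred_eq, hb]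
        constructor
        · rintro ⟨i, hi, rfl⟩; exact hi
        · intro hq; exact ⟨⟨q, hBi.subset_extend _ hq⟩, hq, rfl⟩
      rw [this, hBs]
      exact subset_span hp
    intro i hi
    exact b.repr_support_subset_of_mem_span _ hps hi
  have hpI : p = ∑ i ∈ I, b i := repr_sum b p
  obtain ⟨w, hw, hwx, rfl⟩ := mem_tt.1 hp
  have hp0 : f w ≠ 0 := (mem_con.1 (tt_sub_con hf h0 hp)).1
  rcases lt_or_ge I.card 3 with hc | hc
  · interval_cases h : I.card
    · rw [Finset.card_eq_zero] at h
      rw [h] at hpI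
      exact hp0 (by simpa using hpI)
    · obtain ⟨i, hi⟩ := Finset.card_eq_one.1 h
      rw [hi, Finset.sum_singleton, hb] at hpI
      apply hpB
      rw [hpI]
      apply hIB
      simp [hi]
    · obtain ⟨i, j, hij, hi⟩ := Finset.card_eq_two.1 h
      rw [hi, Finset.sum_pair hij, hb, hb] at hpI
      refine hnF i (hBt (hIB i (by simp [hi]))) j (hBt (hIB j (by simp [hi]))) ?_ ?_
      · rwa [Ne, Subtype.coe_inj]
      · rw [← hpI]; exact hp
  · apply hAG
    exact quad hf b η hη I hc (fun i hi => hηS i (hIB i hi)) ∅ (by simp) w (w + x) hw hwx hpI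
      (by
        have : w + (w + x) + x = 0 := by linear_combination (norm := module) dbl w + dbl x
        simp [this])

theorem tt_nofano {S : Finset V} {f : V →ₗ[ZMod 2] W} {x : V} (hf : IsCon f x) (h0 : (0 : V) ∉ S)
    (hx : x ∈ S) (hx' : ∀ F, IsFano S F → x ∉ F) :
    ∀ p ∈ tt S x f, ∀ q ∈ tt S x f, p ≠ q → p + q ∉ tt S x f := by
  intro p hp q hq hpq hpq'
  have hp0 := (mem_con.1 (tt_sub_con hf h0 hp)).1
  have hq0 := (mem_con.1 (tt_sub_con hf h0 hq)).1
  obtain ⟨u, hu, hu', rfl⟩ := mem_tt.1 hp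
  obtain ⟨v, hv, hv', rfl⟩ := mem_tt.1 hq
  obtain ⟨w, hw, hw', hwe⟩ := mem_tt.1 hpq'
  have hS : u + v ∈ S ∧ u + v + x ∈ S := by
    rw [← map_add] at hwe
    rcases hf.eq_iff.1 hwe with rfl | rfl
    · exact ⟨hw, hw'⟩
    · refine ⟨?_, hw⟩
      rwa [add_assoc, dbl, add_zero] at hw'
  have hli : LinearIndependent (ZMod 2) ![x, u, v] := by
    rw [Fintype.linearIndependent_iff]
    intro g hg
    rw [Fin.sum_univ_three] at hg
    simp only [Matrix.cons_val] at hg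
    have hfg : g 1 • f u + g 2 • f v = 0 := by
      have := congrArg f hg
      simpa [hf.map_x] using this
    have hne := hf.ne
    rcases z2 (g 0) with h | h <;> rcases z2 (g 1) with h' | h' <;> rcases z2 (g 2) with h'' | h'' <;>
      simp only [h, h', h'', zero_smul, one_smul, zero_add, add_zero] at hg hfg
    · intro i; fin_cases i <;> assumption
    all_goals first
      | exact absurd hfg hp0
      | exact absurd hfg hq0
      | exact absurd (add_eq_zero_iff'.1 hfg) hpq
      | exact absurd hg hne
  apply hx' (span (ZMod 2) (Set.range ![x, u, v])) ⟨?_, ?_⟩ (subset_span ⟨0, rfl⟩)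
  · rw [finrank_span_eq_card hli]; simp
  · intro s hs hs0
    rw [mem_span_range_iff_exists_fun] at hs
    obtain ⟨c, rfl⟩ := hs
    rw [Fin.sum_univ_three] at hs0 ⊢
    simp only [Matrix.cons_val] at hs0 ⊢
    rcases z2 (c 0) with h | h <;> rcases z2 (c 1) with h' | h' <;> rcases z2 (c 2) with h'' | h'' <;>
      simp only [h, h', h'', zero_smul, one_smul, zero_add, add_zero] at hs0 ⊢
    · exact absurd rfl hs0
    · exact hv
    · exact hu
    · exact hS.1
    · exact hx
    · rwa [add_comm]
    · rwa [add_comm]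
    · rw [add_assoc, add_comm]; exact hS.2

end AGP

namespace AGP
universe u
set_option linter.unusedSectionVars false
open Submodule Module

variable {V W : Type u} [AddCommGroup V] [Module (ZMod 2) V] [AddCommGroup W] [Module (ZMod 2) W]

theorem exists_notMem {P Q : Submodule (ZMod 2) V} [FiniteDimensional (ZMod 2) Q]
    (h : finrank (ZMod 2) Q < finrank (ZMod 2) P) : ∃ v ∈ P, v ∉ Q := by
  by_contra! hc
  exact absurd (Submodule.finrank_mono (show P ≤ Q from hc)) (by omega)

theorem mem_span_one {a v : V} : v ∈ span (ZMod 2) {a} ↔ v = 0 ∨ v = a := by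
  rw [mem_span_singleton]
  constructor
  · rintro ⟨c, rfl⟩
    rcases z2 c with rfl | rfl <;> simp
  · rintro (rfl | rfl)
    · exact ⟨0, by simp⟩
    · exact ⟨1, by simp⟩

theorem mem_span_two {a b v : V} : v ∈ span (ZMod 2) {a, b} ↔ v = 0 ∨ v = a ∨ v = b ∨ v = a + b := by
  rw [mem_span_pair]
  constructor
  · rintro ⟨c, d, rfl⟩
    rcases z2 c with rfl | rfl <;> rcases z2 d with rfl | rfl <;> simp
  · rintro (rfl | rfl | rfl | rfl)
    · exact ⟨0, 0, by simp⟩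
    · exact ⟨1, 0, by simp⟩
    · exact ⟨0, 1, by simp⟩
    · exact ⟨1, 1, by simp⟩

theorem exists_two {P : Submodule (ZMod 2) V} (h : 2 ≤ finrank (ZMod 2) P) :
    ∃ a ∈ P, ∃ b ∈ P, a ≠ 0 ∧ b ≠ 0 ∧ a ≠ b := by
  obtain ⟨a, ha, ha0⟩ := exists_notMem (P := P) (Q := ⊥) (by rw [finrank_bot]; omega)
  obtain ⟨b, hb, hb0⟩ := exists_notMem (P := P) (Q := span (ZMod 2) {a})
    (by rw [finrank_span_singleton (by simpa using ha0)]; omega)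
  rw [mem_span_one] at hb0
  push Not at hb0
  exact ⟨a, ha, b, hb, by simpa using ha0, hb0.1, hb0.2.symm⟩

theorem IsFano.fin {S : Finset V} {F : Submodule (ZMod 2) V} (h : IsFano S F) :
    FiniteDimensional (ZMod 2) F := FiniteDimensional.of_finrank_pos (by rw [h.1]; omega)

theorem IsFano.le_span {S : Finset V} {F : Submodule (ZMod 2) V} (h : IsFano S F) :
    F ≤ span (ZMod 2) (S : Set V) := by
  intro v hv
  by_cases h0 : v = 0
  · rw [h0]; exact zero_mem _
  · exact subset_span (h.2 v hv h0)

theorem twofano {S : Finset V} {F F' : Submodule (ZMod 2) V} (hF : IsFano S F) (hF' : IsFano S F')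
    (hne : F ≠ F') (h2 : 2 ≤ finrank (ZMod 2) ↥(F ⊓ F')) : HasAG (S : Set V) := by
  have := hF.fin
  have := hF'.fin
  obtain ⟨a, ⟨ha, ha'⟩, b, ⟨hb, hb'⟩, ha0, hb0, hab⟩ := exists_two h2
  have hc : ∃ c ∈ F, c ∉ F' := by
    by_contra! hc
    exact hne (Submodule.eq_of_le_of_finrank_eq hc (by rw [hF.1, hF'.1]))
  have hd : ∃ d ∈ F', d ∉ F := by
    by_contra! hc
    exact hne (Submodule.eq_of_le_of_finrank_eq hc (by rw [hF.1, hF'.1])).symm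
  obtain ⟨c, hc, hc'⟩ := hc
  obtain ⟨d, hd, hd'⟩ := hd
  refine ⟨∅, c, a, b, c + d, by simp, ?_, ?_⟩
  · intro α β γ δ h
    simp only [span_empty, mem_bot] at h
    have hδ : δ = 0 := by
      rcases z2 δ with h' | h'
      · exact h'
      · exfalso
        apply hd'
        have : d = -(α • c + β • a + γ • b + c) := by
          rw [h', one_smul] at h
          linear_combination (norm := module) h
        rw [this]
        exact neg_mem (add_mem (add_mem (add_mem (smul_mem _ _ hc) (smul_mem _ _ ha))
          (smul_mem _ _ hb)) hc)
    subst hδ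
    have hα : α = 0 := by
      rcases z2 α with h' | h'
      · exact h'
      · exfalso
        apply hc'
        have : c = -(β • a + γ • b) := by
          rw [h', one_smul] at h
          linear_combination (norm := module) h
        rw [this]
        exact neg_mem (add_mem (smul_mem _ _ ha') (smul_mem _ _ hb'))
    subst hα
    rcases z2 β with rfl | rfl <;> rcases z2 γ with rfl | rfl <;> simp at h ⊢
    · exact hb0 h
    · exact ha0 h
    · exact hab (add_eq_zero_iff'.1 h)
  · intro β γ δ
    rcases z2 δ with rfl | rfl
    · refine ⟨c + β • a + γ • b, hF.2 _ (add_mem (add_mem hc (smul_mem _ _ ha)) (smul_mem _ _ hb)) ?_,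
        by simp [dbl]⟩
      intro h
      apply hc'
      have : c = -(β • a + γ • b) := by
        linear_combination (norm := module) h
      rw [this]
      exact neg_mem (add_mem (smul_mem _ _ ha') (smul_mem _ _ hb'))
    · refine ⟨d + β • a + γ • b,
        hF'.2 _ (add_mem (add_mem hd (smul_mem _ _ ha')) (smul_mem _ _ hb')) ?_, ?_⟩
      · intro h
        apply hd'
        have : d = -(β • a + γ • b) := by
          linear_combination (norm := module) h
        rw [this]
        exact neg_mem (add_mem (smul_mem _ _ ha) (smul_mem _ _ hb))
      · have : d + β • a + γ • b + (c + β • a + γ • b + (1 : ZMod 2) • (c + d)) = 0 := by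
          linear_combination (norm := module) dbl d + dbl c + dbl (β • a) + dbl (γ • b)
        rw [this]
        exact zero_mem _

theorem IsFano.con {S : Finset V} {F : Submodule (ZMod 2) V} {f : V →ₗ[ZMod 2] W} {e : V}
    (hF : IsFano S F) (hf : IsCon f e) (he : e ∉ F) : IsFano (con S f) (F.map f) := by
  have := hF.fin
  constructor
  · rw [← LinearMap.range_domRestrict, LinearMap.finrank_range_of_inj, hF.1]
    rw [← LinearMap.ker_eq_bot, LinearMap.ker_eq_bot']
    rintro ⟨v, hv⟩ h
    rcases (hf.ker v).1 h with h | h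
    · simp [h]
    · subst h; exact absurd hv he
  · rintro _ ⟨v, hv, rfl⟩ h
    refine mem_con.2 ⟨h, v, hF.2 v hv ?_, rfl⟩
    rintro rfl
    exact h (map_zero f)

set_option maxHeartbeats 2000000 in
theorem link (n : ℕ) : ∀ {V : Type u} [AddCommGroup V] [Module (ZMod 2) V] (S : Finset V),
    S.card = n → (0 : V) ∉ S → ¬ HasAG (S : Set V) → ∀ F F', IsFano S F → IsFano S F' → F ≠ F' →
    ∃ X Y : Finset V, (∀ s, s ∈ S ↔ s ∈ X ∨ s ∈ Y) ∧ (∀ v ∈ F, v ≠ 0 → v ∈ X) ∧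
      (∀ v ∈ F', v ≠ 0 → v ∈ Y) ∧ rk X + rk Y ≤ rk S + 1 := by
  classical
  induction n using Nat.strong_induction_on with
  | _ n ih =>
  intro V _ _ S hn h0 hAG F F' hF hF' hne
  have := hF.fin
  have := hF'.fin
  have hdim := Submodule.finrank_sup_add_finrank_inf_eq F F'
  rw [hF.1, hF'.1] at hdim
  have hinf : ¬ 2 ≤ finrank (ZMod 2) ↥(F ⊓ F') := fun h => hAG (twofano hF hF' hne h)
  by_cases hcov : ∀ s ∈ S, s ∈ F ∨ s ∈ F'
  · refine ⟨S.filter (· ∈ F), S.filter (· ∈ F'), ?_, ?_, ?_, ?_⟩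
    · intro s
      simp only [Finset.mem_filter]
      have := hcov s
      tauto
    · intro v hv hv0; simp [hv, hF.2 v hv hv0]
    · intro v hv hv0; simp [hv, hF'.2 v hv hv0]
    · have h1 : rk (S.filter (· ∈ F)) ≤ 3 := by
        rw [← hF.1]
        exact Submodule.finrank_mono (span_le.2 (by intro v; simp))
      have h2 : rk (S.filter (· ∈ F')) ≤ 3 := by
        rw [← hF'.1]
        exact Submodule.finrank_mono (span_le.2 (by intro v; simp))
      have h3 := le_rk (S := S) (F ⊔ F') (sup_le hF.le_span hF'.le_span)
      omega
  · push Not at hcov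
    obtain ⟨e, he, heF, heF'⟩ := hcov
    have he0 : e ≠ 0 := fun h => h0 (h ▸ he)
    have hf := isCon_mkQ e he0
    set f := (span (ZMod 2) {e}).mkQ with hfdef
    have hFe : IsFano (S.erase e) F :=
      ⟨hF.1, fun v hv hv0 => Finset.mem_erase.2 ⟨fun h => heF (h ▸ hv), hF.2 v hv hv0⟩⟩
    have hFe' : IsFano (S.erase e) F' :=
      ⟨hF'.1, fun v hv hv0 => Finset.mem_erase.2 ⟨fun h => heF' (h ▸ hv), hF'.2 v hv hv0⟩⟩
    have hcard := Finset.card_erase_lt_of_mem he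
    obtain ⟨X, Y, hXY, hFX, hFY, hrk⟩ := ih _ (hn ▸ hcard) (S.erase e) rfl
      (fun h => h0 (Finset.mem_of_mem_erase h))
      (fun h => hAG (h.mono (by simp))) F F' hFe hFe' hne
    have hcc := card_con hf h0 he
    have hmapne : F.map f ≠ F'.map f := by
      intro h
      apply hinf
      have hle : F ⊔ F' ≤ F ⊔ span (ZMod 2) {e} := by
        refine sup_le le_sup_left ?_
        intro v hv
        have : f v ∈ F.map f := by rw [h]; exact ⟨v, hv, rfl⟩
        obtain ⟨u, hu, huv⟩ := this
        rcases hf.eq_iff.1 huv.symm with h | h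
        · rw [h]; exact mem_sup_left hu
        · rw [h]; exact add_mem (mem_sup_left hu) (mem_sup_right (mem_span_singleton_self e))
      have h1 := Submodule.finrank_mono hle
      have h2 := Submodule.finrank_add_le_finrank_add_finrank F (span (ZMod 2) {e})
      rw [finrank_span_singleton he0, hF.1] at h2
      omega
    obtain ⟨X1, Y1, hXY1, hFX1, hFY1, hrk1⟩ := ih (con S f).card (by omega) (con S f) rfl
      (zero_notMem_con S f) (con_AG hf he hAG) _ _ (hF.con hf heF) (hF'.con hf heF') hmapne
    have hrc := rk_con hf he
    set X' := (S.erase e).filter (fun s => f s ∈ X1) with hX'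
    set Y' := (S.erase e).filter (fun s => f s ∈ Y1) with hY'
    have key : ∀ (Z : Finset V) (Z1 : Finset (V ⧸ span (ZMod 2) {e})), (∀ z ∈ Z, f z ∈ Z1) →
        rk (insert e Z) ≤ rk Z1 + 1 := by
      intro Z Z1 hZ
      have h1 := hf.finrank_map (span (ZMod 2) ((insert e Z : Finset V) : Set V))
        (subset_span (by simp))
      unfold rk
      rw [← h1]
      apply Nat.add_le_add_right
      apply Submodule.finrank_mono
      rw [map_span_le]
      intro v hv
      rcases Finset.mem_insert.1 hv with h | h
      · rw [h, hf.map_x]; exact zero_mem _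
      · exact subset_span (hZ v h)
    have hk1 := key X' X1 (fun z hz => (Finset.mem_filter.1 hz).2)
    have hk2 := key Y' Y1 (fun z hz => (Finset.mem_filter.1 hz).2)
    have hs1 := rk_submod X (insert e X')
    have hs2 := rk_submod Y (insert e Y')
    have hm := rk_mono (Finset.erase_subset e S)
    have hcov1 : ∀ s ∈ S, s ≠ e → s ∈ X' ∨ s ∈ Y' := by
      intro s hs hse
      have : f s ∈ con S f := by
        refine mem_con.2 ⟨fun h => ?_, s, hs, rfl⟩
        rcases (hf.ker s).1 h with h | h
        · exact h0 (h ▸ hs)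
        · exact hse h
      simp only [hX', hY', Finset.mem_filter, Finset.mem_erase]
      have := (hXY1 _).1 this
      tauto
    have hcov0 : ∀ s ∈ S, s ≠ e → s ∈ X ∨ s ∈ Y := fun s hs hse =>
      (hXY s).1 (Finset.mem_erase.2 ⟨hse, hs⟩)
    have hXS : ∀ s ∈ X, s ∈ S := fun s hs => Finset.mem_of_mem_erase ((hXY s).2 (Or.inl hs))
    have hYS : ∀ s ∈ Y, s ∈ S := fun s hs => Finset.mem_of_mem_erase ((hXY s).2 (Or.inr hs))
    have hXS' : ∀ s ∈ X', s ∈ S := fun s hs => Finset.mem_of_mem_erase (Finset.mem_filter.1 hs).1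
    have hYS' : ∀ s ∈ Y', s ∈ S := fun s hs => Finset.mem_of_mem_erase (Finset.mem_filter.1 hs).1
    have hfv : ∀ v ∈ S, v ≠ e → f v ≠ 0 := by
      intro v hv hve h
      rcases (hf.ker v).1 h with h | h
      · exact h0 (h ▸ hv)
      · exact hve h
    have hFX' : ∀ v ∈ F, v ≠ 0 → v ∈ X' := by
      intro v hv hv0
      have hve : v ≠ e := fun h => heF (h ▸ hv)
      exact Finset.mem_filter.2 ⟨hFe.2 v hv hv0, hFX1 _ ⟨v, hv, rfl⟩ (hfv v (hF.2 v hv hv0) hve)⟩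
    have hFY' : ∀ v ∈ F', v ≠ 0 → v ∈ Y' := by
      intro v hv hv0
      have hve : v ≠ e := fun h => heF' (h ▸ hv)
      exact Finset.mem_filter.2 ⟨hFe'.2 v hv hv0, hFY1 _ ⟨v, hv, rfl⟩ (hfv v (hF'.2 v hv hv0) hve)⟩
    by_cases hfin : rk (X ∪ insert e X') + rk (Y ∩ insert e Y') ≤ rk S + 1
    · refine ⟨X ∪ insert e X', Y ∩ insert e Y', ?_, ?_, ?_, hfin⟩
      · intro s
        simp only [Finset.mem_union, Finset.mem_inter, Finset.mem_insert]
        constructor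
        · intro hs
          have := hcov1 s hs; have := hcov0 s hs; tauto
        · rintro ((h | h | h) | ⟨h, -⟩)
          · exact hXS s h
          · rw [h]; exact he
          · exact hXS' s h
          · exact hYS s h
      · intro v hv hv0; exact Finset.mem_union_left _ (hFX v hv hv0)
      · intro v hv hv0
        exact Finset.mem_inter.2 ⟨hFY v hv hv0, Finset.mem_insert_of_mem (hFY' v hv hv0)⟩
    · refine ⟨X ∩ insert e X', Y ∪ insert e Y', ?_, ?_, ?_, by omega⟩
      · intro s
        simp only [Finset.mem_union, Finset.mem_inter, Finset.mem_insert]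
        constructor
        · intro hs
          have := hcov1 s hs; have := hcov0 s hs; tauto
        · rintro (⟨h, -⟩ | (h | h | h))
          · exact hXS s h
          · exact hYS s h
          · rw [h]; exact he
          · exact hYS' s h
      · intro v hv hv0
        exact Finset.mem_inter.2 ⟨hFX v hv hv0, Finset.mem_insert_of_mem (hFX' v hv hv0)⟩
      · intro v hv hv0; exact Finset.mem_union_left _ (hFY v hv hv0)

theorem card_tt_le {S : Finset V} {f : V →ₗ[ZMod 2] W} {x : V} (hf : IsCon f x) (h0 : (0 : V) ∉ S)
    (hx : x ∈ S) (hAG : ¬ HasAG (S : Set V)) (hx' : ∀ F, IsFano S F → x ∉ F) :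
    (tt S x f).card + 1 ≤ rk S := by
  have h := tt_indep hf h0 hAG (tt_nofano hf h0 hx hx')
  rw [← rk_con hf hx]
  apply Nat.add_le_add_right
  rw [← finrank_span_finset_eq_card h]
  refine Submodule.finrank_mono (span_mono ?_)
  exact_mod_cast tt_sub_con hf h0

end AGP

namespace AGP
universe u
set_option linter.unusedSectionVars false
open Submodule Module

variable {V W : Type u} [AddCommGroup V] [Module (ZMod 2) V] [AddCommGroup W] [Module (ZMod 2) W]

theorem ag441 {S : Set V} {π : V →ₗ[ZMod 2] W} (hK : ∀ v, π v = 0 → v ≠ 0 → v ∈ S) {p q : W}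
    (hp : p ≠ 0) (hq : q ≠ 0) (hpq : p ≠ q) {z a b c d : V} (hz : π z = p) (ha : π a = q)
    (hb : π b = q) (hc : π c = q) (hd : π d = q) (hab : a ≠ b) (hac : a ≠ c) (had : a ≠ d)
    (hbc : b ≠ c) (hbd : b ≠ d) (hcd : c ≠ d) (haS : a ∈ S) (hbS : b ∈ S) (hcS : c ∈ S)
    (hdS : d ∈ S) (haz : a + z ∈ S) (hbz : b + z ∈ S) (hcz : c + z ∈ S) (hdz : d + z ∈ S) :
    HasAG S := by
  have hs : π (a + b + c + d) = 0 := by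
    simp only [map_add, ha, hb, hc, hd]; rw [dbl, zero_add, dbl]
  have hspan : span (ZMod 2) ({a + b + c + d} \ {0} : Set V) = span (ZMod 2) {a + b + c + d} :=
    span_sdiff_singleton_zero
  refine ⟨{a + b + c + d} \ {0}, a, a + b, a + c, z, ?_, ?_, ?_⟩
  · rintro v ⟨hv, hv0⟩
    rw [mem_singleton_iff] at hv hv0
    rw [hv] at hv0 ⊢
    exact hK _ hs hv0
  · intro α β γ δ h
    rw [hspan, mem_span_one] at h
    have h2 : α • q + δ • p = 0 := by
      have : π (α • a + β • (a + b) + γ • (a + c) + δ • z) = 0 := by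
        rcases h with h | h
        · rw [h, map_zero]
        · rw [h, hs]
      simpa [ha, hb, hc, hz, dbl] using this
    have h3 : α = 0 ∧ δ = 0 := by
      rcases z2 α with rfl | rfl <;> rcases z2 δ with rfl | rfl <;> simp at h2 ⊢
      · exact hp h2
      · exact hq h2
      · exact hpq (add_eq_zero_iff'.1 h2).symm
    obtain ⟨rfl, rfl⟩ := h3
    have := dbl a; have := dbl b; have := dbl c; have := dbl d
    rcases z2 β with rfl | rfl <;> rcases z2 γ with rfl | rfl <;>
      simp only [zero_smul, one_smul, zero_add, add_zero] at h ⊢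
    · simp
    · exfalso
      rcases h with h | h
      · exact hac (add_eq_zero_iff'.1 h)
      · exact hbd (add_eq_zero_iff'.1 (by grind))
    · exfalso
      rcases h with h | h
      · exact hab (add_eq_zero_iff'.1 h)
      · exact hcd (add_eq_zero_iff'.1 (by grind))
    · exfalso
      rcases h with h | h
      · exact hbc (add_eq_zero_iff'.1 (by grind))
      · exact had (add_eq_zero_iff'.1 (by grind))
  · intro β γ δ
    rw [hspan]
    simp only [mem_span_one]
    have h1 : ∀ t, t ∈ S → t + z ∈ S → ∃ s ∈ S, s = t + δ • z := by
      intro t ht ht'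
      rcases z2 δ with rfl | rfl
      · exact ⟨t, ht, by simp⟩
      · exact ⟨_, ht', by simp⟩
    have := dbl a; have := dbl b; have := dbl c; have := dbl d; have := dbl (δ • z)
    rcases z2 β with rfl | rfl <;> rcases z2 γ with rfl | rfl <;>
      simp only [zero_smul, one_smul, zero_add, add_zero]
    · obtain ⟨s, hs, h⟩ := h1 a haS haz
      refine ⟨s, hs, Or.inl ?_⟩
      rw [h, dbl]
    · obtain ⟨s, hs, h⟩ := h1 c hcS hcz
      refine ⟨s, hs, Or.inl ?_⟩
      rw [h]; linear_combination (norm := module) dbl a + dbl c + dbl (δ • z)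
    · obtain ⟨s, hs, h⟩ := h1 b hbS hbz
      refine ⟨s, hs, Or.inl ?_⟩
      rw [h]; linear_combination (norm := module) dbl a + dbl b + dbl (δ • z)
    · obtain ⟨s, hs, h⟩ := h1 d hdS hdz
      refine ⟨s, hs, Or.inr ?_⟩
      rw [h]; linear_combination (norm := module) dbl a + dbl (δ • z)

theorem ag333 {S : Set V} {π : V →ₗ[ZMod 2] W} (hK : ∀ v, π v = 0 → v ≠ 0 → v ∈ S) {p q : W}
    (hp : p ≠ 0) (hq : q ≠ 0) (hpq : p ≠ q) {z u v v' h : V} (hz : π z = p) (hu : π u = q)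
    (hv : π v = q) (hv' : π v' = q) (huv : u ≠ v) (huv' : u ≠ v') (hvv' : v ≠ v')
    (hzS : z ∈ S) (huS : u ∈ S) (hvS : v ∈ S) (hvS' : v' ∈ S) (hw : z + u + v + v' ∈ S)
    (hh : π h = 0) (hD : h ∉ span (ZMod 2) {v + v', v + u}) :
    HasAG S := by
  rw [mem_span_two] at hD
  push Not at hD
  obtain ⟨h0, h1, h2, h3⟩ := hD
  have e1 := dbl u; have e2 := dbl v; have e3 := dbl v'; have e4 := dbl h; have e5 := dbl z
  refine ⟨{z}, v, v + v', v + u, v + h, by simpa using hzS, ?_, ?_⟩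
  · intro α β γ δ hh'
    rw [mem_span_one] at hh'
    have hπ : π (α • v + β • (v + v') + γ • (v + u) + δ • (v + h)) = (α + δ) • q := by
      simp [hu, hv, hv', hh, dbl, add_smul]
    have hz0 : α • v + β • (v + v') + γ • (v + u) + δ • (v + h) = 0 := by
      rcases hh' with hh' | hh'
      · exact hh'
      · exfalso
        rw [hh', hz] at hπ
        rcases z2 (α + δ) with h | h <;> rw [h] at hπ
        · simp at hπ; exact hp hπ
        · simp at hπ; exact hpq hπ
    rw [hz0, map_zero] at hπ
    have hαδ : α = δ := by
      clear hz0 hh'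
      rcases z2 α with rfl | rfl <;> rcases z2 δ with rfl | rfl
      · rfl
      · exact absurd (by simpa using hπ.symm) hq
      · exact absurd (by simpa using hπ.symm) hq
      · rfl
    subst hαδ
    rcases z2 α with rfl | rfl <;> rcases z2 β with rfl | rfl <;> rcases z2 γ with rfl | rfl <;>
      simp only [zero_smul, one_smul, zero_add, add_zero] at hz0 ⊢
    · simp
    · exact absurd (add_eq_zero_iff'.1 hz0).symm huv
    · exact absurd (add_eq_zero_iff'.1 hz0) hvv'
    · exact absurd (add_eq_zero_iff'.1 (show u + v' = 0 by grind)) huv'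
    · exact absurd (show h = 0 by grind) h0
    · exact absurd (add_eq_zero_iff'.1 (show h + (v + u) = 0 by grind)) h2
    · exact absurd (add_eq_zero_iff'.1 (show h + (v + v') = 0 by grind)) h1
    · exact absurd (add_eq_zero_iff'.1 (show h + (v + v' + (v + u)) = 0 by grind)) h3
  · intro β γ δ
    simp only [mem_span_one]
    rcases z2 δ with rfl | rfl <;> rcases z2 β with rfl | rfl <;> rcases z2 γ with rfl | rfl <;>
      simp only [zero_smul, one_smul, zero_add, add_zero]
    · exact ⟨v, hvS, Or.inl e2⟩
    · exact ⟨u, huS, Or.inl (by grind)⟩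
    · exact ⟨v', hvS', Or.inl (by grind)⟩
    · exact ⟨_, hw, Or.inr (by grind)⟩
    · exact ⟨h, hK _ hh h0, Or.inl (by grind)⟩
    · refine ⟨h + (v + u), hK _ (by simp [hh, hv, hu, dbl])
        (fun e => h2 (add_eq_zero_iff'.1 e)), Or.inl (by grind)⟩
    · refine ⟨h + (v + v'), hK _ (by simp [hh, hv, hv', dbl])
        (fun e => h1 (add_eq_zero_iff'.1 e)), Or.inl (by grind)⟩
    · refine ⟨h + (v + v' + (v + u)), hK _ (by simp [hh, hv, hv', hu, dbl])
        (fun e => h3 (add_eq_zero_iff'.1 e)), Or.inl (by grind)⟩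

end AGP

namespace AGP
universe u
set_option linter.unusedSectionVars false
open Submodule Module

variable {V W : Type u} [AddCommGroup V] [Module (ZMod 2) V] [AddCommGroup W] [Module (ZMod 2) W]

theorem five_nofano {S : Finset V} (h0 : (0 : V) ∉ S) (hcard : S.card = 16)
    (h8 : ∀ x ∈ S, (dd S x).card = 8) : False := by
  classical
  let T := S.sigma (fun x => dd S x)
  have hT : T.card = 128 := by
    rw [Finset.card_sigma, Finset.sum_congr rfl h8, Finset.sum_const, hcard]
    rfl
  have hmem : ∀ p : (_ : V) × V, p ∈ T ↔ p.1 ∈ S ∧ p.2 ∈ S ∧ p.2 + p.1 ∈ S := by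
    intro p
    simp [T, mem_dd]
  let g : T → T := fun p => ⟨⟨p.1.2, p.1.2 + p.1.1⟩, by
    have h := (hmem _).1 p.2
    rw [hmem]
    refine ⟨h.2.1, h.2.2, ?_⟩
    have : p.1.2 + p.1.1 + p.1.2 = p.1.1 := by
      linear_combination (norm := module) dbl p.1.2
    rw [this]; exact h.1⟩
  have hg : (show Function.End T from g) ^ 3 ^ 1 = 1 := by
    funext p
    obtain ⟨⟨a, b⟩, hp⟩ := p
    have : ((show Function.End T from g) ^ 3 ^ 1) ⟨⟨a, b⟩, hp⟩ = g (g (g ⟨⟨a, b⟩, hp⟩)) := rfl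
    rw [this]
    simp only [g, Function.End.one_def, id_eq]
    apply Subtype.ext
    have e1 : b + a + b = a := by linear_combination (norm := module) dbl b
    have e2 : a + (b + a) = b := by linear_combination (norm := module) dbl a
    simp only [e1, e2]
  have := Equiv.Perm.card_fixedPoints_modEq (p := 3) (n := 1) hg
  rw [Fintype.card_coe, hT, Fintype.card_eq_zero_iff.2] at this
  · exact absurd this (by decide)
  · constructor
    rintro ⟨⟨⟨a, b⟩, hp⟩, h⟩
    have h : g ⟨⟨a, b⟩, hp⟩ = ⟨⟨a, b⟩, hp⟩ := h
    have h := congrArg Subtype.val h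
    simp only [g, Sigma.mk.injEq, heq_eq_eq] at h
    have ha : a = 0 := by simpa using h.2
    apply h0
    rw [← ha]
    exact ((hmem _).1 hp).1

theorem comb333 {A1 A2 A3 : Finset V} (h1 : A1.card = 3) (h2 : A2.card = 3) (h3 : A3.card = 3)
    (h : ∀ z ∈ A1, ∃ v ∈ A2, ∃ v' ∈ A2, v ≠ v' ∧ v + z ∈ A3 ∧ v' + z ∈ A3 ∧
      ∀ u ∈ A2, u + z ∈ A3 → u = v ∨ u = v')
    (hpl : ∀ z ∈ A1, z + ∑ v ∈ A2, v ∉ A3) : False := by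
  classical
  set m := ∑ v ∈ A2, v with hm
  set m' := ∑ v ∈ A3, v with hm'
  have key : ∀ z ∈ A1, ∃ u ∈ A2, u + z ∉ A3 ∧ m + m' + u ∈ A3 ∧
      ∀ v ∈ A2, v ≠ u → v + z ∈ A3 ∧ v + z ≠ m + m' + u := by
    intro z hz
    obtain ⟨v, hv, v', hv', hvv, hvz, hvz', hall⟩ := h z hz
    obtain ⟨u, hu⟩ : ∃ u, A2 \ {v, v'} = {u} := by
      rw [← Finset.card_eq_one, Finset.card_sdiff_of_subset (by simp [Finset.insert_subset_iff, *]), h2,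
        Finset.card_pair hvv]
    obtain ⟨w, hw⟩ : ∃ u, A3 \ {v + z, v' + z} = {u} := by
      rw [← Finset.card_eq_one, Finset.card_sdiff_of_subset (by simp [Finset.insert_subset_iff, *]), h3,
        Finset.card_pair (by simpa using hvv)]
    have hum : u ∈ A2 \ {v, v'} := by rw [hu]; simp
    have hwm : w ∈ A3 \ {v + z, v' + z} := by rw [hw]; simp
    have hms : m = u + (v + v') := by
      rw [hm, ← Finset.sum_sdiff (show {v, v'} ⊆ A2 by simp [Finset.insert_subset_iff, *]), hu,
        Finset.sum_singleton, Finset.sum_pair hvv]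
    have hms' : m' = w + (v + z + (v' + z)) := by
      rw [hm', ← Finset.sum_sdiff (show {v + z, v' + z} ⊆ A3 by simp [Finset.insert_subset_iff, *]), hw,
        Finset.sum_singleton, Finset.sum_pair (by simpa using hvv)]
    have hwe : m + m' + u = w := by
      have := dbl u; have := dbl v; have := dbl v'; have := dbl z
      grind
    simp only [Finset.mem_sdiff, Finset.mem_insert, Finset.mem_singleton, not_or] at hum hwm
    have huz : u + z ∉ A3 := fun h => by
      rcases hall u hum.1 h with h | h
      · exact hum.2.1 h
      · exact hum.2.2 h
    refine ⟨u, hum.1, huz, hwe ▸ hwm.1, fun t ht htu => ?_⟩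
    have ht' : t = v ∨ t = v' := by
      by_contra hc
      push Not at hc
      have : t ∈ A2 \ {v, v'} := by simp [ht, hc.1, hc.2]
      rw [hu] at this
      exact htu (by simpa using this)
    rw [hwe]
    rcases ht' with rfl | rfl
    · exact ⟨hvz, fun h => hwm.2.1 h.symm⟩
    · exact ⟨hvz', fun h => hwm.2.2 h.symm⟩
  have hA3 : ∀ a b c d, a ∈ A3 → b ∈ A3 → c ∈ A3 → d ∈ A3 → a ≠ b → a ≠ c → b ≠ c →
      d = a ∨ d = b ∨ d = c := by
    intro a b c d ha hb hc hd hab hac hbc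
    have : ({a, b, c} : Finset V) = A3 := by
      apply Finset.eq_of_subset_of_card_le
      · simp [Finset.insert_subset_iff, *]
      · rw [h3, Finset.card_eq_three.2 ⟨a, b, c, hab, hac, hbc, rfl⟩]
    rw [← this] at hd
    simpa using hd
  have hsame : ∀ z ∈ A1, ∀ z' ∈ A1, ∀ u ∈ A2, ∀ u' ∈ A2, u ≠ u' → u + z ∉ A3 → m + m' + u ∈ A3 →
      m + m' + u' ∈ A3 → (∀ v ∈ A2, v ≠ u → v + z ∈ A3 ∧ v + z ≠ m + m' + u) → False := by
    intro z hz z' hz' u hu u' hu' huu hzu hk hk' hall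
    obtain ⟨u'', hu''⟩ : ∃ t, A2 \ {u, u'} = {t} := by
      rw [← Finset.card_eq_one, Finset.card_sdiff_of_subset (by simp [Finset.insert_subset_iff, *]), h2,
        Finset.card_pair huu]
    have hum : u'' ∈ A2 \ {u, u'} := by rw [hu'']; simp
    simp only [Finset.mem_sdiff, Finset.mem_insert, Finset.mem_singleton, not_or] at hum
    have hms : m = u'' + (u + u') := by
      rw [hm, ← Finset.sum_sdiff (show {u, u'} ⊆ A2 by simp [Finset.insert_subset_iff, *]), hu'',
        Finset.sum_singleton, Finset.sum_pair huu]
    have hne : m + m' + u ≠ m + m' + u' := by simpa using huu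
    obtain ⟨w, hw⟩ : ∃ t, A3 \ {m + m' + u, m + m' + u'} = {t} := by
      rw [← Finset.card_eq_one, Finset.card_sdiff_of_subset
        (Finset.insert_subset_iff.2 ⟨hk, Finset.singleton_subset_iff.2 hk'⟩), h3,
        Finset.card_pair hne]
    have hwm : w ∈ A3 \ {m + m' + u, m + m' + u'} := by rw [hw]; simp
    simp only [Finset.mem_sdiff, Finset.mem_insert, Finset.mem_singleton, not_or] at hwm
    have hms' : m' = w + (m + m' + u + (m + m' + u')) := by
      nth_rewrite 1 [hm']
      rw [← Finset.sum_sdiff (show {m + m' + u, m + m' + u'} ⊆ A3 from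
        Finset.insert_subset_iff.2 ⟨hk, Finset.singleton_subset_iff.2 hk'⟩), hw,
        Finset.sum_singleton, Finset.sum_pair hne]
    have d1 := dbl u; have d2 := dbl u'; have d3 := dbl u''; have d4 := dbl z
    have d5 := dbl m; have d6 := dbl m'
    have hwe : w = m + m' + u'' := by
      clear hA3 key
      linear_combination (norm := module) - hms' + hms - d5 - d5 - d6
    obtain ⟨hz1, hz2⟩ := hall u' hu' huu.symm
    rcases hA3 _ _ _ _ hk hk' hwm.1 hz1 hne (Ne.symm hwm.2.1) (Ne.symm hwm.2.2) with h | h | h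
    · exact hz2 h
    · apply hzu
      have : z = m + m' := by grind
      rw [this, add_comm]; exact hk
    · apply hpl z hz
      have : z + m = m + m' + u := by
        rw [hwe] at h
        linear_combination (norm := module) h + hms + d3
      rw [this]; exact hk
  obtain ⟨z1, z2, z3, h12, h13, h23, rfl⟩ := Finset.card_eq_three.1 h1
  obtain ⟨u1, hu1, hz1, hk1, hl1⟩ := key z1 (by simp)
  obtain ⟨u2, hu2, hz2, hk2, hl2⟩ := key z2 (by simp)
  obtain ⟨u3, hu3, hz3, hk3, hl3⟩ := key z3 (by simp)
  by_cases e12 : u1 = u2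
  · by_cases e13 : u1 = u3
    · subst e12 e13
      obtain ⟨v, hv⟩ : (A2.erase u1).Nonempty := by
        rw [← Finset.card_pos, Finset.card_erase_of_mem hu1, h2]; norm_num
      rw [Finset.mem_erase] at hv
      obtain ⟨a1, b1⟩ := hl1 v hv.2 hv.1
      obtain ⟨a2, b2⟩ := hl2 v hv.2 hv.1
      obtain ⟨a3, b3⟩ := hl3 v hv.2 hv.1
      rcases hA3 _ _ _ _ a1 a2 a3 hk1 (by simpa using h12) (by simpa using h13)
        (by simpa using h23) with h | h | h
      · exact b1 h.symm
      · exact b2 h.symm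
      · exact b3 h.symm
    · exact hsame z1 (by simp) z3 (by simp) u1 hu1 u3 hu3 e13 hz1 hk1 hk3 hl1
  · exact hsame z1 (by simp) z2 (by simp) u1 hu1 u2 hu2 e12 hz1 hk1 hk2 hl1
end AGP

namespace AGP
universe u
set_option linter.unusedSectionVars false
open Submodule Module

variable {V W : Type u} [AddCommGroup V] [Module (ZMod 2) V] [AddCommGroup W] [Module (ZMod 2) W]

theorem finrank_pair_le (a b : V) : finrank (ZMod 2) (span (ZMod 2) {a, b}) ≤ 2 := by
  classical
  have h := finrank_span_finset_le_card (R := ZMod 2) ({a, b} : Finset V)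
  rw [Set.finrank, Finset.coe_pair] at h
  exact h.trans Finset.card_le_two

theorem finrank_pair {a b : V} (ha : a ≠ 0) (hb : b ≠ 0) (hab : a ≠ b) :
    2 ≤ finrank (ZMod 2) (span (ZMod 2) {a, b}) := by
  have h1 : span (ZMod 2) {a} < span (ZMod 2) {a, b} := by
    refine lt_of_le_of_ne (span_mono (by simp)) ?_
    intro h
    have : b ∈ span (ZMod 2) {a} := by rw [h]; exact subset_span (by simp)
    rw [mem_span_one] at this
    rcases this with h | h
    · exact hb h
    · exact hab h.symm
  have : FiniteDimensional (ZMod 2) (span (ZMod 2) {a, b}) :=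
    FiniteDimensional.span_of_finite _ (Set.toFinite _)
  have := Submodule.finrank_lt_finrank_of_lt h1
  rw [finrank_span_singleton ha] at this
  omega

theorem mem_of_two {L : Submodule (ZMod 2) W} (hL : finrank (ZMod 2) L = 2) {p q t : W} (hp : p ∈ L)
    (hq : q ∈ L) (hp0 : p ≠ 0) (hq0 : q ≠ 0) (hpq : p ≠ q) (ht : t ∈ L) :
    t = 0 ∨ t = p ∨ t = q ∨ t = p + q := by
  have : FiniteDimensional (ZMod 2) L := FiniteDimensional.of_finrank_pos (by omega)
  rw [← mem_span_two]
  have : span (ZMod 2) {p, q} = L := by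
    apply Submodule.eq_of_le_of_finrank_le
    · rw [span_le]; rintro x (rfl | rfl) <;> assumption
    · rw [hL]; exact finrank_pair hp0 hq0 hpq
  rw [this]; exact ht

theorem finrank_map_mkQ {P F : Submodule (ZMod 2) V} [FiniteDimensional (ZMod 2) P] (h : F ≤ P) :
    finrank (ZMod 2) (P.map F.mkQ) + finrank (ZMod 2) F = finrank (ZMod 2) P := by
  have h1 := LinearMap.finrank_range_add_finrank_ker (F.mkQ.domRestrict P)
  rw [LinearMap.range_domRestrict, LinearMap.ker_domRestrict, ker_mkQ] at h1
  rw [← h1, (Submodule.comapSubtypeEquivOfLe h).finrank_eq]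

theorem card_four {A : Finset V} (h : A.card = 4) : ∃ a b c d, a ≠ b ∧ a ≠ c ∧ a ≠ d ∧ b ≠ c ∧
    b ≠ d ∧ c ≠ d ∧ a ∈ A ∧ b ∈ A ∧ c ∈ A ∧ d ∈ A := by
  classical
  obtain ⟨a, t, ha, rfl, ht⟩ := Finset.card_eq_succ.1 h
  obtain ⟨b, c, d, hbc, hbd, hcd, rfl⟩ := Finset.card_eq_three.1 ht
  simp at ha
  refine ⟨a, b, c, d, ha.1, ha.2.1, ha.2.2, hbc, hbd, hcd, ?_, ?_, ?_, ?_⟩ <;> simp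

open Classical in
theorem five_fano {S : Finset V} {F : Submodule (ZMod 2) V} (hF : IsFano S F) (h0 : (0 : V) ∉ S)
    (hAG : ¬ HasAG (S : Set V)) (hrk : rk S = 5) (hcard : S.card = 16)
    (h8 : ∀ x ∈ S, x ∉ F → (dd S x).card = 8)
    (h4 : ∀ T ⊆ S, rk T ≤ 4 → T.card ≤ 11) : False := by
  have := hF.fin
  set π := F.mkQ with hπ
  have hker : ∀ v, π v = 0 ↔ v ∈ F := fun v => by rw [hπ, mkQ_apply, Quotient.mk_eq_zero]
  have hK : ∀ v, π v = 0 → v ≠ 0 → v ∈ (S : Set V) := fun v hv hv0 => hF.2 v ((hker v).1 hv) hv0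
  set L := (span (ZMod 2) (S : Set V)).map π with hLdef
  have hL : finrank (ZMod 2) L = 2 := by
    have h : finrank (ZMod 2) L + _ = _ := finrank_map_mkQ hF.le_span
    rw [hF.1] at h
    unfold rk at hrk
    rw [hrk] at h
    omega
  let A : (V ⧸ F) → Finset V := fun t => S.filter (fun s => π s = t)
  have mA : ∀ t s, s ∈ A t ↔ s ∈ S ∧ π s = t := fun t s => by simp [A]
  let G : (V ⧸ F) → (V ⧸ F) → Prop := fun t t' => t ∈ L ∧ t' ∈ L ∧ t ≠ 0 ∧ t' ≠ 0 ∧ t ≠ t'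
  have Gsymm : ∀ t t', G t t' → G t' t := fun t t' h => ⟨h.2.1, h.1, h.2.2.2.1, h.2.2.1, h.2.2.2.2.symm⟩
  have Gadd : ∀ t t', G t t' → G t (t + t') := fun t t' h =>
    ⟨h.1, add_mem h.1 h.2.1, h.2.2.1, fun e => h.2.2.2.2 (add_eq_zero_iff'.1 e),
      fun e => h.2.2.2.1 (by simpa using e)⟩
  have G4 : ∀ t t', G t t' → ∀ s ∈ S, π s = 0 ∨ π s = t ∨ π s = t' ∨ π s = t + t' := by
    rintro t t' ⟨h1, h2, h3, h4, h5⟩ s hs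
    exact mem_of_two hL h1 h2 h3 h4 h5 ⟨s, subset_span hs, rfl⟩
  have fib : ∀ t t', G t t' → ∀ T ⊆ S, T.card = (T.filter (fun s => π s = 0)).card
      + (T.filter (fun s => π s = t)).card + (T.filter (fun s => π s = t')).card
      + (T.filter (fun s => π s = t + t')).card := by
    intro t t' hG T hT
    rw [Finset.card_eq_sum_card_fiberwise (f := π) (t := {0, t, t', t + t'})]
    · obtain ⟨-, -, h3, h4, h5⟩ := hG
      have h6 : t + t' ≠ 0 := fun e => h5 (add_eq_zero_iff'.1 e)
      rw [Finset.sum_insert, Finset.sum_insert, Finset.sum_insert, Finset.sum_singleton]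
      · ring
      · simp [h3]
      · simp [h5, h4]
      · simp [h3.symm, h4.symm, h6.symm]
    · intro s hs
      have := G4 t t' hG s (hT hs)
      simpa using this
  have hA0 : (A 0).card = 7 := by
    have h1 : ((insert 0 (A 0) : Finset V) : Set V) = F := by
      ext v
      simp only [Finset.coe_insert, Set.mem_insert_iff, Finset.mem_coe, mA, hker, SetLike.mem_coe]
      constructor
      · rintro (rfl | h)
        · exact zero_mem F
        · exact h.2
      · intro h
        by_cases hv : v = 0
        · exact Or.inl hv
        · exact Or.inr ⟨hF.2 v h hv, h⟩
    have h2 : (insert 0 (A 0) : Finset V).card = 2 ^ 3 := by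
      rw [← Set.ncard_coe_finset, h1, ← hF.1]
      have := Module.natCard_eq_pow_finrank (K := ZMod 2) (V := F)
      rw [Nat.card_zmod] at this
      exact this
    rw [Finset.card_insert_of_notMem (by simp [mA, h0])] at h2
    omega
  have hsum : ∀ t t', G t t' → (A t).card + (A t').card + (A (t + t')).card = 9 := by
    intro t t' hG
    have := fib t t' hG S (Finset.Subset.refl _)
    simp only [A] at hA0 ⊢
    omega
  have hle4 : ∀ t, t ≠ 0 → (A t).card ≤ 4 := by
    intro t ht
    rcases (A t).eq_empty_or_nonempty with h | ⟨z, hz⟩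
    · rw [h]; simp
    · have h1 : (A 0 ∪ A t).card ≤ 11 := by
        apply h4
        · intro s hs
          rcases Finset.mem_union.1 hs with h | h
          · exact ((mA _ _).1 h).1
          · exact ((mA _ _).1 h).1
        · have h2 : span (ZMod 2) ((A 0 ∪ A t : Finset V) : Set V) ≤ F ⊔ span (ZMod 2) {z} := by
            rw [span_le]
            intro s hs
            rcases Finset.mem_union.1 hs with h | h
            · exact mem_sup_left ((hker _).1 ((mA _ _).1 h).2)
            · have : s = (s + z) + z := by rw [add_assoc, dbl, add_zero]
              rw [this]
              refine add_mem (mem_sup_left ?_) (mem_sup_right (mem_span_singleton_self z))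
              rw [← hker, map_add, ((mA _ _).1 h).2, ((mA _ _).1 hz).2, dbl]
          have h3 := Submodule.finrank_mono h2
          have h4 := Submodule.finrank_add_le_finrank_add_finrank F (span (ZMod 2) {z})
          rw [finrank_span_singleton (fun h => h0 (h ▸ ((mA _ _).1 hz).1)), hF.1] at h4
          unfold rk
          omega
      rw [Finset.card_union_of_disjoint, hA0] at h1
      · omega
      · rw [Finset.disjoint_left]
        intro s hs hs'
        exact ht (((mA _ _).1 hs').2.symm.trans ((mA _ _).1 hs).2)
  have deg : ∀ t t', G t t' → ∀ z ∈ A t,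
      ((A t').filter (fun v => v + z ∈ A (t + t'))).card + (A t).card = 5 := by
    intro t t' hG z hz
    obtain ⟨hzS, hzt⟩ := (mA _ _).1 hz
    have hzF : z ∉ F := fun h => hG.2.2.1 (by rw [← hzt, hker]; exact h)
    have hd := fib t t' hG (dd S z) (fun s hs => (mem_dd.1 hs).1)
    rw [h8 z hzS hzF] at hd
    have shift : ∀ c, ((dd S z).filter (fun s => π s = c)).card =
        ((dd S z).filter (fun s => π s = t + c)).card := by
      intro c
      apply Finset.card_bij (fun s _ => s + z)
      · intro s hs
        simp only [Finset.mem_filter, mem_dd] at hs ⊢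
        refine ⟨⟨hs.1.2, ?_⟩, ?_⟩
        · rw [add_assoc, dbl, add_zero]; exact hs.1.1
        · rw [map_add, hs.2, hzt, add_comm]
      · intro a _ b _ h; simpa using h
      · intro s hs
        simp only [Finset.mem_filter, mem_dd] at hs ⊢
        refine ⟨s + z, ⟨⟨hs.1.2, ?_⟩, ?_⟩, ?_⟩
        · rw [add_assoc, dbl, add_zero]; exact hs.1.1
        · rw [map_add, hs.2, hzt, add_comm t c, add_assoc, dbl, add_zero]
        · rw [add_assoc, dbl, add_zero]
    have s0 := shift 0
    have s1 := shift t'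
    rw [add_zero] at s0
    have e1 : (dd S z).filter (fun s => π s = t) = (A t).erase z := by
      ext s
      simp only [Finset.mem_filter, mem_dd, Finset.mem_erase, mA]
      constructor
      · rintro ⟨⟨h1, h2⟩, h3⟩
        refine ⟨?_, h1, h3⟩
        rintro rfl
        rw [dbl] at h2; exact h0 h2
      · rintro ⟨h1, h2, h3⟩
        refine ⟨⟨h2, hK _ ?_ ?_⟩, h3⟩
        · rw [map_add, h3, hzt, dbl]
        · exact fun h => h1 (add_eq_zero_iff'.1 h)
    have e2 : (dd S z).filter (fun s => π s = t') = (A t').filter (fun v => v + z ∈ A (t + t')) := by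
      ext s
      simp only [Finset.mem_filter, mem_dd, mA]
      constructor
      · rintro ⟨⟨h1, h2⟩, h3⟩
        refine ⟨⟨h1, h3⟩, h2, ?_⟩
        rw [map_add, h3, hzt, add_comm]
      · rintro ⟨⟨h1, h2⟩, h3, -⟩
        exact ⟨⟨h1, h3⟩, h2⟩
    have e3 := Finset.card_erase_of_mem hz
    have e4 : 0 < (A t).card := Finset.card_pos.2 ⟨z, hz⟩
    rw [← e2]
    rw [e1] at hd s0
    omega
  have dbc : ∀ t t', G t t' → (A t).card * (5 - (A t).card) = (A t').card * (5 - (A t').card) := by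
    intro t t' hG
    have h := Finset.sum_card_bipartiteAbove_eq_sum_card_bipartiteBelow (s := A t) (t := A t')
      (fun z v => v + z ∈ A (t + t'))
    have h1 : ∑ z ∈ A t, (Finset.bipartiteAbove (fun z v => v + z ∈ A (t + t')) (A t') z).card
        = (A t).card * (5 - (A t).card) := by
      rw [← smul_eq_mul, ← Finset.sum_const]
      apply Finset.sum_congr rfl
      intro z hz
      have := deg t t' hG z hz
      unfold Finset.bipartiteAbove
      beta_reduce
      omega
    have h2 : ∑ z ∈ A t', (Finset.bipartiteBelow (fun z v => v + z ∈ A (t + t')) (A t) z).card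
        = (A t').card * (5 - (A t').card) := by
      rw [← smul_eq_mul, ← Finset.sum_const]
      apply Finset.sum_congr rfl
      intro z hz
      have := deg t' t (Gsymm _ _ hG) z hz
      unfold Finset.bipartiteBelow
      simp only [add_comm z, add_comm t t']
      omega
    rw [← h1, ← h2, h]
  have c441 : ∀ t t', G t t' → (A t).card = 1 → (A t').card = 4 → False := by
    intro t t' hG h1 h2
    obtain ⟨z, hz⟩ := Finset.card_eq_one.1 h1
    have hz : z ∈ A t := by rw [hz]; simp
    have hd := deg t t' hG z hz
    have hall : (A t').filter (fun v => v + z ∈ A (t + t')) = A t' :=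
      Finset.eq_of_subset_of_card_le (Finset.filter_subset _ _) (by omega)
    have hall' : ∀ v ∈ A t', v + z ∈ S := by
      intro v hv
      rw [← hall, Finset.mem_filter] at hv
      exact ((mA _ _).1 hv.2).1
    obtain ⟨a, b, c, d, hab, hac, had, hbc, hbd, hcd, ha, hb, hc, hd⟩ := card_four h2
    exact hAG (ag441 hK hG.2.2.1 hG.2.2.2.1 hG.2.2.2.2 ((mA _ _).1 hz).2 ((mA _ _).1 ha).2
      ((mA _ _).1 hb).2 ((mA _ _).1 hc).2 ((mA _ _).1 hd).2 hab hac had hbc hbd hcd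
      ((mA _ _).1 ha).1 ((mA _ _).1 hb).1 ((mA _ _).1 hc).1 ((mA _ _).1 hd).1
      (hall' a ha) (hall' b hb) (hall' c hc) (hall' d hd))
  have c333 : ∀ t t', G t t' → (A t).card = 3 → (A t').card = 3 → (A (t + t')).card = 3 → False := by
    intro t t' hG h1 h2 h3
    refine comb333 h1 h2 h3 ?_ ?_
    · intro z hz
      have hd := deg t t' hG z hz
      obtain ⟨v, v', hvv, he⟩ := Finset.card_eq_two.1
        (show ((A t').filter (fun v => v + z ∈ A (t + t'))).card = 2 by omega)
      have hv : v ∈ (A t').filter (fun v => v + z ∈ A (t + t')) := by rw [he]; simp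
      have hv' : v' ∈ (A t').filter (fun v => v + z ∈ A (t + t')) := by rw [he]; simp
      rw [Finset.mem_filter] at hv hv'
      refine ⟨v, hv.1, v', hv'.1, hvv, hv.2, hv'.2, fun u hu hu' => ?_⟩
      have : u ∈ (A t').filter (fun v => v + z ∈ A (t + t')) := Finset.mem_filter.2 ⟨hu, hu'⟩
      rw [he] at this
      simpa using this
    · intro z hz hw
      obtain ⟨u, v, v', huv, huv', hvv, he⟩ := Finset.card_eq_three.1 h2
      have hu : u ∈ A t' := by rw [he]; simp
      have hv : v ∈ A t' := by rw [he]; simp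
      have hv' : v' ∈ A t' := by rw [he]; simp
      rw [he, Finset.sum_insert (by simp [huv, huv']), Finset.sum_pair hvv] at hw
      have : FiniteDimensional (ZMod 2) (span (ZMod 2) {v + v', v + u}) :=
        FiniteDimensional.span_of_finite _ (Set.toFinite _)
      obtain ⟨h, hhF, hh⟩ := exists_notMem (P := F) (Q := span (ZMod 2) {v + v', v + u}) (by
        rw [hF.1]; exact lt_of_le_of_lt (finrank_pair_le _ _) (by norm_num))
      refine hAG (ag333 hK hG.2.2.1 hG.2.2.2.1 hG.2.2.2.2 ((mA _ _).1 hz).2 ((mA _ _).1 hu).2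
        ((mA _ _).1 hv).2 ((mA _ _).1 hv').2 huv huv' hvv ((mA _ _).1 hz).1 ((mA _ _).1 hu).1
        ((mA _ _).1 hv).1 ((mA _ _).1 hv').1 ?_ ((hker h).2 hhF) hh)
      have : z + u + v + v' = z + (u + (v + v')) := by abel
      rw [this]
      exact ((mA _ _).1 hw).1
  obtain ⟨p, hp, q, hq, hp0, hq0, hpq⟩ := exists_two (P := L) (by omega)
  have hG : G p q := ⟨hp, hq, hp0, hq0, hpq⟩
  have hG1 := Gsymm _ _ hG
  have hG2 := Gadd _ _ hG
  have hG3 := Gsymm _ _ hG2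
  have k1 := hsum _ _ hG
  have k2 := dbc _ _ hG
  have k3 := dbc _ _ hG2
  have l1 := hle4 p hp0
  have l2 := hle4 q hq0
  have l3 := hle4 (p + q) hG2.2.2.2.1
  have m1 := c441 _ _ hG
  have m2 := c441 _ _ hG1
  have m3 := c441 _ _ hG3
  have m4 := c333 _ _ hG
  clear c333 c441 dbc deg hle4 hsum
  generalize (A p).card = a at k1 k2 k3 l1 l2 l3 m1 m2 m3 m4
  generalize (A q).card = b at k1 k2 k3 l1 l2 l3 m1 m2 m3 m4
  generalize (A (p + q)).card = c at k1 k2 k3 l1 l2 l3 m1 m2 m3 m4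
  clear hG hG1 hG2 hG3 hA0 fib G4 Gadd Gsymm mA h8 h4 hcard hAG hF hK hker
  obtain rfl : c = 9 - a - b := by omega
  clear_value G A
  clear G A
  interval_cases a <;> interval_cases b <;> first | omega | simp at k2 k3 m1 m2 m3 m4
end AGP

namespace AGP
universe u
set_option linter.unusedSectionVars false
open Submodule Module

variable {V W : Type u} [AddCommGroup V] [Module (ZMod 2) V] [AddCommGroup W] [Module (ZMod 2) W]

/-- The extremal bound in rank `r`. -/
def Bd (r : ℕ) : Prop := ∀ (V : Type u) [AddCommGroup V] [Module (ZMod 2) V] (S : Finset V),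
  (0 : V) ∉ S → ¬ HasAG (S : Set V) → rk S = r →
    2 * S.card ≤ r * (r + 1) + 2 ∧ (5 ≤ r → 2 * S.card ≤ r * (r + 1))

theorem card_lt_two_pow {S : Finset V} (h0 : (0 : V) ∉ S) : S.card + 1 ≤ 2 ^ rk S := by
  classical
  rw [← Finset.card_insert_of_notMem h0, ← Set.ncard_coe_finset]
  have : FiniteDimensional (ZMod 2) (span (ZMod 2) (S : Set V)) :=
    FiniteDimensional.span_of_finite _ (Set.toFinite _)
  have h := Module.natCard_eq_pow_finrank (K := ZMod 2) (V := span (ZMod 2) (S : Set V))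
  rw [Nat.card_zmod] at h
  unfold rk
  rw [← h]
  have hfin : Finite (span (ZMod 2) (S : Set V)) := Module.finite_of_finite (ZMod 2)
  have hfin' : ((span (ZMod 2) (S : Set V) : Submodule (ZMod 2) V) : Set V).Finite := hfin
  change _ ≤ ((span (ZMod 2) (S : Set V) : Submodule (ZMod 2) V) : Set V).ncard
  refine Set.ncard_le_ncard ?_ hfin'
  intro v hv
  rcases Finset.mem_insert.1 (Finset.mem_coe.1 hv) with rfl | h
  · exact zero_mem _
  · exact subset_span h

theorem two_fano_lt {r : ℕ} (hB : ∀ k < r, Bd.{u} k) {S : Finset V} (h0 : (0 : V) ∉ S)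
    (hAG : ¬ HasAG (S : Set V)) (hrk : rk S = r) {F F' : Submodule (ZMod 2) V}
    (hF : IsFano S F) (hF' : IsFano S F') (hne : F ≠ F') : 5 ≤ r ∧ 2 * S.card < r * (r + 1) := by
  classical
  obtain ⟨X, Y, hXY, hX, hY, hr⟩ := link _ S rfl h0 hAG F F' hF hF' hne
  have hXS : X ⊆ S := fun s hs => (hXY s).2 (Or.inl hs)
  have hYS : Y ⊆ S := fun s hs => (hXY s).2 (Or.inr hs)
  have ha : 3 ≤ rk X := hF.1 ▸ le_rk F (IsFano.le_span (S := X) ⟨hF.1, hX⟩)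
  have hb : 3 ≤ rk Y := hF'.1 ▸ le_rk F' (IsFano.le_span (S := Y) ⟨hF'.1, hY⟩)
  have b1 := (hB (rk X) (by omega) V X (fun h => h0 (hXS h))
    (fun h => hAG (h.mono (Finset.coe_subset.2 hXS))) rfl).1
  have b2 := (hB (rk Y) (by omega) V Y (fun h => h0 (hYS h))
    (fun h => hAG (h.mono (Finset.coe_subset.2 hYS))) rfl).1
  have hc : S.card ≤ X.card + Y.card := by
    refine (Finset.card_le_card (t := X ∪ Y) ?_).trans (Finset.card_union_le _ _)
    intro s hs
    exact Finset.mem_union.2 ((hXY s).1 hs)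
  refine ⟨by omega, ?_⟩
  rw [hrk] at hr
  obtain ⟨a, ha'⟩ := Nat.exists_eq_add_of_le ha
  obtain ⟨b, hb'⟩ := Nat.exists_eq_add_of_le hb
  rw [ha'] at b1 hr
  rw [hb'] at b2 hr
  obtain ⟨c, rfl⟩ : ∃ c, r = a + b + 5 + c := ⟨r - (a + b + 5), by omega⟩
  nlinarith [Nat.zero_le (a * b), Nat.zero_le (a * c), Nat.zero_le (b * c), Nat.zero_le (c * c)]

theorem exists_nonfano {S : Finset V} (hone : ∀ F F', IsFano S F → IsFano S F' → F = F')
    (hrk : 4 ≤ rk S) : ∃ x ∈ S, ∀ F, IsFano S F → x ∉ F := by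
  by_cases h : ∃ F, IsFano S F
  · obtain ⟨F, hF⟩ := h
    by_contra hcon
    push Not at hcon
    have : span (ZMod 2) (S : Set V) ≤ F := by
      rw [span_le]
      intro x hx
      obtain ⟨F', hF', hx'⟩ := hcon x hx
      rw [hone F F' hF hF']; exact hx'
    have hfin := hF.fin
    have := Submodule.finrank_mono this
    rw [hF.1] at this
    unfold rk at hrk
    omega
  · push Not at h
    have : S.Nonempty := by
      rw [Finset.nonempty_iff_ne_empty]
      rintro rfl
      rw [rk, Finset.coe_empty, span_empty, finrank_bot] at hrk
      omega
    obtain ⟨x, hx⟩ := this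
    exact ⟨x, hx, fun F hF => absurd hF (h F)⟩

theorem bound_all (r : ℕ) : Bd.{u} r := by
  induction r using Nat.strong_induction_on with
  | _ r hB =>
  intro V _ _ S h0 hAG hrk
  by_cases hr : r ≤ 3
  · have := card_lt_two_pow h0
    rw [hrk] at this
    refine ⟨?_, by omega⟩
    interval_cases r <;> omega
  push Not at hr
  by_cases hone : ∀ F F', IsFano S F → IsFano S F' → F = F'
  swap
  · push Not at hone
    obtain ⟨F, F', hF, hF', hne⟩ := hone
    have := two_fano_lt hB h0 hAG hrk hF hF' hne
    exact ⟨by omega, fun _ => by omega⟩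
  have step : ∀ x ∈ S, (∀ F, IsFano S F → x ∉ F) → ∃ c t, S.card = 1 + c + t ∧ t + 1 ≤ r ∧
      (dd S x).card = 2 * t ∧
      2 * c ≤ (r - 1) * (r - 1 + 1) + 2 ∧ (5 ≤ r - 1 → 2 * c ≤ (r - 1) * (r - 1 + 1)) := by
    intro x hx hxF
    have hf := isCon_mkQ x (fun h => h0 (h ▸ hx))
    have h1 := card_con hf h0 hx
    have h2 := card_tt_le hf h0 hx hAG hxF
    have h3 := rk_con hf hx
    have h4 := hB (r - 1) (by omega) _ _ (zero_notMem_con S _) (con_AG hf hx hAG) (by omega)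
    exact ⟨_, _, h1, by omega, card_dd hf, h4.1, h4.2⟩
  obtain ⟨x, hx, hxF⟩ := exists_nonfano hone (by omega)
  obtain ⟨c, t, e1, e2, e3, e4, e5⟩ := step x hx hxF
  by_cases hr6 : 6 ≤ r
  · have e6 := e5 (by omega)
    obtain ⟨k, rfl⟩ : ∃ k, r = k + 1 := ⟨r - 1, by omega⟩
    simp only [Nat.add_sub_cancel] at e6
    have : 2 * S.card ≤ (k + 1) * (k + 1 + 1) := by rw [e1]; nlinarith
    exact ⟨by omega, fun _ => this⟩
  obtain rfl | rfl : r = 4 ∨ r = 5 := by omega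
  · refine ⟨by omega, by omega⟩
  have hle : S.card ≤ 16 := by omega
  have hne : S.card ≠ 16 := by
    intro h16
    have h8 : ∀ x ∈ S, (∀ F, IsFano S F → x ∉ F) → (dd S x).card = 8 := by
      intro x hx hxF
      obtain ⟨c, t, e1, e2, e3, e4, e5⟩ := step x hx hxF
      omega
    have h4 : ∀ T ⊆ S, rk T ≤ 4 → T.card ≤ 11 := by
      intro T hT hTr
      have := (hB (rk T) (by omega) V T (fun h => h0 (hT h))
        (fun h => hAG (h.mono (Finset.coe_subset.2 hT))) rfl).1
      have : rk T * (rk T + 1) ≤ 4 * 5 := Nat.mul_le_mul hTr (by omega)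
      omega
    by_cases h : ∃ F, IsFano S F
    · obtain ⟨F, hF⟩ := h
      exact five_fano hF h0 hAG hrk h16 (fun x hx hxF => h8 x hx
        (fun F' hF' => hone F F' hF hF' ▸ hxF)) h4
    · push Not at h
      exact five_nofano h0 h16 (fun x hx => h8 x hx (fun F hF => absurd hF (h F)))
  exact ⟨by omega, fun _ => by omega⟩
end AGP

namespace AGP
universe u
set_option linter.unusedSectionVars false
open Submodule Module

variable {V W : Type u} [AddCommGroup V] [Module (ZMod 2) V] [AddCommGroup W] [Module (ZMod 2) W]

section
variable {ι : Type u}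

/-- support of `f v` in the basis `b` -/
noncomputable def supp (b : Basis ι (ZMod 2) W) (f : V →ₗ[ZMod 2] W) (v : V) : Finset ι :=
  (b.repr (f v)).support

theorem mem_supp {b : Basis ι (ZMod 2) W} {f : V →ₗ[ZMod 2] W} {v : V} {i : ι} :
    i ∈ supp b f v ↔ b.repr (f v) i = 1 := by
  rw [supp, Finsupp.mem_support_iff]
  rcases z2 (b.repr (f v) i) with h | h <;> rw [h] <;> decide

theorem mem_supp_add {b : Basis ι (ZMod 2) W} {f : V →ₗ[ZMod 2] W} {u v : V} {i : ι} :
    i ∈ supp b f (u + v) ↔ ¬ (i ∈ supp b f u ↔ i ∈ supp b f v) := by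
  simp only [mem_supp, map_add, Finsupp.add_apply]
  rcases z2 (b.repr (f u) i) with h | h <;> rcases z2 (b.repr (f v) i) with h' | h' <;>
    rw [h, h'] <;> decide

theorem supp_eq_iff {b : Basis ι (ZMod 2) W} {f : V →ₗ[ZMod 2] W} {u v : V} :
    supp b f u = supp b f v ↔ f u = f v := by
  constructor
  · intro h
    rw [repr_sum b (f u), repr_sum b (f v)]
    unfold supp at h
    rw [h]
  · intro h
    unfold supp
    rw [h]

theorem supp_singleton {b : Basis ι (ZMod 2) W} {f : V →ₗ[ZMod 2] W} {v : V} {i : ι} :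
    supp b f v = {i} ↔ f v = b i := by
  constructor
  · intro h
    rw [repr_sum b (f v)]
    unfold supp at h
    rw [h]; simp
  · intro h
    unfold supp
    rw [h, b.repr_self, Finsupp.support_single _ (by decide)]

theorem supp_empty {b : Basis ι (ZMod 2) W} {f : V →ₗ[ZMod 2] W} {v : V} :
    supp b f v = ∅ ↔ f v = 0 := by
  unfold supp; simp

theorem supp_pair {b : Basis ι (ZMod 2) W} {f : V →ₗ[ZMod 2] W} {v : V} {i j : ι} [DecidableEq ι]
    (hij : i ≠ j) (h : supp b f v = {i, j}) : f v = b i + b j := by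
  rw [repr_sum b (f v)]
  unfold supp at h
  rw [h, Finset.sum_pair hij]

end

theorem dd_ge {n : ℕ} (hn : 5 ≤ n) {S : Finset V} (h0 : (0 : V) ∉ S) (hAG : ¬ HasAG (S : Set V))
    (hrk : rk S = n + 1) (hcard : 2 * S.card = (n + 1) * (n + 2))
    {f : V →ₗ[ZMod 2] W} {x : V} (hf : IsCon f x) (hx : x ∈ S) : n ≤ (tt S x f).card := by
  have h1 := card_con hf h0 hx
  have h3 := rk_con hf hx
  have h4 := (bound_all n _ _ (zero_notMem_con S _) (con_AG hf hx hAG) (by omega)).2 hn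
  nlinarith

open Classical in
theorem STR {n : ℕ} (hn : 5 ≤ n) {S : Finset V} (h0 : (0 : V) ∉ S) (hAG : ¬ HasAG (S : Set V))
    (hspan : span (ZMod 2) (S : Set V) = ⊤)
    (hrk : rk S = n + 1) (hcard : 2 * S.card = (n + 1) * (n + 2))
    {f : V →ₗ[ZMod 2] W} {x : V} (hf : IsCon f x) (hx : x ∈ S)
    (hxF : ∀ F, IsFano S F → x ∉ F) :
    ∃ (ι : Type u) (_ : Fintype ι) (b : Basis ι (ZMod 2) W) (η : ι → V), Fintype.card ι = n ∧
      (∀ i, f (η i) = b i ∧ η i ∈ S ∧ η i + x ∈ S) ∧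
      (∀ i j, i ≠ j → η i + η j ∈ S ∨ η i + η j + x ∈ S) ∧
      (∀ i j, i ≠ j → η i + η j ∈ S → η i + η j + x ∈ S → False) ∧
      ∀ s ∈ S, s = x ∨ ∃ i, s = η i ∨ s = η i + x ∨ ∃ j, i ≠ j ∧ f s = b i + b j := by
  have htt : (tt S x f).card = n := by
    have h1 := dd_ge hn h0 hAG hrk hcard hf hx
    have h2 := card_tt_le hf h0 hx hAG hxF
    omega
  have hli : LinearIndependent (ZMod 2) (fun p : tt S x f => (p : W)) :=
    tt_indep hf h0 hAG (tt_nofano hf h0 hx hxF)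
  have hfr : finrank (ZMod 2) W = n := by
    have h := rk_con hf hx
    rw [rk, span_con, hspan, Submodule.map_top, LinearMap.range_eq_top.2 hf.surj, finrank_top] at h
    omega
  have : Nonempty (tt S x f) := by
    rw [Finset.nonempty_coe_sort, ← Finset.card_pos]; omega
  let b : Basis (tt S x f) (ZMod 2) W :=
    basisOfLinearIndependentOfCardEqFinrank hli (by rw [hfr, Fintype.card_coe, htt])
  have hb : ∀ i, b i = i := fun i => by simp [b]
  have hη : ∀ i : tt S x f, ∃ s ∈ S, s + x ∈ S ∧ f s = b i := fun i => by
    rw [hb]; exact mem_tt.1 i.2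
  choose η hηS hηx hηf using hη
  clear_value b
  have hY1 : ∀ v, v ∈ dd S x → ∃ t, supp b f v = {t} := by
    intro v hv
    have : f v ∈ tt S x f := mem_tt.2 ⟨v, (mem_dd.1 hv).1, (mem_dd.1 hv).2, rfl⟩
    exact ⟨⟨f v, this⟩, supp_singleton.2 (by rw [hb])⟩
  have hsη : ∀ v t, supp b f v = {t} → v = η t ∨ v = η t + x := by
    intro v t h
    rw [supp_singleton, ← hηf, hf.eq_iff] at h
    exact h
  have hY2 : ∀ v t, supp b f v = {t} → v ∈ dd S x := by
    intro v t h
    rcases hsη v t h with rfl | rfl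
    · exact mem_dd.2 ⟨hηS t, hηx t⟩
    · exact mem_dd.2 ⟨hηx t, by rw [add_assoc, dbl, add_zero]; exact hηS t⟩
  have hY0 : ∀ v ∈ S, supp b f v = ∅ → v = x := by
    intro v hv h
    rw [supp_empty, hf.ker] at h
    rcases h with rfl | h
    · exact absurd hv h0
    · exact h
  have hsx : ∀ v, supp b f (v + x) = supp b f v := by
    intro v
    rw [supp_eq_iff, map_add, hf.map_x, add_zero]
  have hYc : (dd S x).card = 2 * n := by rw [card_dd hf, htt]
  let U := S.filter (fun v => 2 ≤ (supp b f v).card)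
  have mU : ∀ v, v ∈ U ↔ v ∈ S ∧ 2 ≤ (supp b f v).card := fun v => by simp [U]
  have hUc : 2 * U.card = n * (n - 1) := by
    have h1 : S.filter (fun v => ¬ 2 ≤ (supp b f v).card) = insert x (dd S x) := by
      ext v
      simp only [Finset.mem_filter, Finset.mem_insert]
      constructor
      · rintro ⟨hv, h⟩
        have : (supp b f v).card = 0 ∨ (supp b f v).card = 1 := by omega
        rcases this with h | h
        · exact Or.inl (hY0 v hv (Finset.card_eq_zero.1 h))
        · obtain ⟨t, ht⟩ := Finset.card_eq_one.1 h
          exact Or.inr (hY2 v t ht)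
      · rintro (rfl | h)
        · refine ⟨hx, ?_⟩
          rw [supp_empty.2 hf.map_x]; simp
        · refine ⟨(mem_dd.1 h).1, ?_⟩
          obtain ⟨t, ht⟩ := hY1 v h
          rw [ht]; simp
    have h2 := Finset.card_filter_add_card_filter_not (s := S) (fun v => 2 ≤ (supp b f v).card)
    rw [h1, Finset.card_insert_of_notMem (by rw [mem_dd, dbl]; exact fun h => h0 h.2), hYc] at h2
    change U.card + _ = _ at h2
    obtain ⟨m, rfl⟩ : ∃ m, n = m + 1 := ⟨n - 1, by omega⟩
    simp only [Nat.add_sub_cancel]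
    nlinarith
  -- the relation
  let R : V → V → Prop := fun y w => w + y ∈ S ∧ supp b f y ⊆ supp b f w
  have hG : ∀ y ∈ dd S x, n - 1 ≤ (Finset.bipartiteAbove R U y).card := by
    intro y hy
    obtain ⟨t, ht⟩ := hY1 y hy
    have hyS := (mem_dd.1 hy).1
    have hf' := isCon_mkQ y (fun h => h0 (h ▸ hyS))
    have h1 := dd_ge hn h0 hAG hrk hcard hf' hyS
    have h2 := card_dd (S := S) hf'
    have mG : ∀ w, w ∈ Finset.bipartiteAbove R U y ↔ w ∈ U ∧ w + y ∈ S ∧ t ∈ supp b f w := by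
      intro w
      rw [Finset.mem_bipartiteAbove]
      simp only [R, ht, Finset.singleton_subset_iff]
    have hsub : dd S y ⊆ {x, y + x} ∪ (Finset.bipartiteAbove R U y ∪
        (Finset.bipartiteAbove R U y).image (fun v => v + y)) := by
      intro v hv
      obtain ⟨hvS, hvy⟩ := mem_dd.1 hv
      rw [Finset.mem_union, Finset.mem_union, Finset.mem_image, Finset.mem_insert,
        Finset.mem_singleton]
      by_cases hvx : v = x
      · exact Or.inl (Or.inl hvx)
      by_cases hvyx : v = y + x
      · exact Or.inl (Or.inr hvyx)
      right
      by_cases htv : t ∈ supp b f v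
      · left
        rw [mG]
        refine ⟨(mU v).2 ⟨hvS, ?_⟩, hvy, htv⟩
        by_contra hc
        have : supp b f v = supp b f y := by
          rw [ht]
          exact (Finset.eq_of_subset_of_card_le (Finset.singleton_subset_iff.2 htv)
            (by rw [Finset.card_singleton]; omega)).symm
        rw [supp_eq_iff, hf.eq_iff] at this
        rcases this with h | h
        · rw [h, dbl] at hvy; exact h0 hvy
        · exact hvyx h
      · right
        refine ⟨v + y, ?_, by rw [add_assoc, dbl, add_zero]⟩
        rw [mG]
        have ht' : t ∈ supp b f (v + y) := by
          rw [mem_supp_add, ht]; simp [htv]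
        refine ⟨(mU _).2 ⟨hvy, ?_⟩, by rw [add_assoc, dbl, add_zero]; exact hvS, ht'⟩
        have hne : (supp b f v).Nonempty := by
          rw [Finset.nonempty_iff_ne_empty]; exact fun h => hvx (hY0 v hvS h)
        obtain ⟨s, hs⟩ := hne
        have hst : s ≠ t := fun h => htv (h ▸ hs)
        have hs' : s ∈ supp b f (v + y) := by
          rw [mem_supp_add, ht]; simp [hs, hst]
        exact Finset.one_lt_card.2 ⟨s, hs', t, ht', hst⟩
    have h3 := Finset.card_le_card hsub
    have h4 := Finset.card_union_le ({x, y + x} : Finset V) (Finset.bipartiteAbove R U y ∪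
        (Finset.bipartiteAbove R U y).image (fun v => v + y))
    have h5 := Finset.card_union_le (Finset.bipartiteAbove R U y)
        ((Finset.bipartiteAbove R U y).image (fun v => v + y))
    have h6 : ((Finset.bipartiteAbove R U y).image (fun v => v + y)).card ≤ _ :=
      Finset.card_image_le
    have h7 : ({x, y + x} : Finset V).card ≤ 2 := Finset.card_le_two
    omega
  have hg4 : ∀ w ∈ U, (Finset.bipartiteBelow R (dd S x) w).card ≤ 4 ∧
      ((supp b f w).card ≠ 2 → (Finset.bipartiteBelow R (dd S x) w).card < 4) := by
    intro w hw
    obtain ⟨hwS, hw2⟩ := (mU w).1 hw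
    have mB : ∀ y, y ∈ Finset.bipartiteBelow R (dd S x) w ↔
        y ∈ dd S x ∧ w + y ∈ S ∧ supp b f y ⊆ supp b f w := by
      intro w
      rw [Finset.mem_bipartiteBelow]
    have hdel : ∀ y t, supp b f y = {t} → t ∈ supp b f w → supp b f (w + y) = (supp b f w).erase t := by
      intro y t ht htw
      ext s
      rw [mem_supp_add, ht, Finset.mem_singleton, Finset.mem_erase]
      by_cases hst : s = t
      · subst hst; simp [htw]
      · simp [hst]
    by_cases h2 : (supp b f w).card = 2
    · refine ⟨?_, fun h => absurd h2 h⟩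
      have hsub : Finset.bipartiteBelow R (dd S x) w ⊆
          (supp b f w).biUnion (fun t => {η t, η t + x}) := by
        intro y hy
        obtain ⟨h1, h2, h3⟩ := (mB y).1 hy
        obtain ⟨t, ht⟩ := hY1 y h1
        rw [Finset.mem_biUnion]
        refine ⟨t, h3 (by rw [ht]; simp), ?_⟩
        simpa using hsη y t ht
      refine (Finset.card_le_card hsub).trans ?_
      refine (Finset.card_biUnion_le_card_mul _ _ 2 (fun _ _ => Finset.card_le_two)).trans ?_
      rw [h2]
    by_cases h3 : (supp b f w).card = 3
    · suffices (Finset.bipartiteBelow R (dd S x) w).card ≤ 3 by omega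
      rw [← h3]
      refine (Finset.card_le_card_of_injOn (supp b f) (t := (supp b f w).image (fun t => {t}))
        ?_ ?_).trans Finset.card_image_le
      · intro y hy
        obtain ⟨h1, h2, h3⟩ := (mB y).1 hy
        obtain ⟨t, ht⟩ := hY1 y h1
        rw [Finset.mem_coe, Finset.mem_image]
        exact ⟨t, h3 (by rw [ht]; simp), ht.symm⟩
      · intro y hy y' hy' he
        obtain ⟨h1, h2, h3⟩ := (mB y).1 hy
        obtain ⟨h1', h2', h3'⟩ := (mB y').1 hy'
        rw [supp_eq_iff, hf.eq_iff] at he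
        rcases he with he | he
        · exact he
        · exfalso
          obtain ⟨t, ht⟩ := hY1 y' h1'
          have htw : t ∈ supp b f w := h3' (by rw [ht]; simp)
          have hd := hdel y' t ht htw
          obtain ⟨t', ht'⟩ := hY1 (w + y') (mem_dd.2 ⟨h2', by rw [add_assoc, ← he]; exact h2⟩)
          have := Finset.card_erase_of_mem htw
          rw [← hd, ht', Finset.card_singleton] at this
          omega
    · suffices (Finset.bipartiteBelow R (dd S x) w).card = 0 by omega
      rw [Finset.card_eq_zero, Finset.eq_empty_iff_forall_notMem]
      intro y hy
      obtain ⟨h1, h2, h3⟩ := (mB y).1 hy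
      obtain ⟨t, ht⟩ := hY1 y h1
      have htw : t ∈ supp b f w := h3 (by rw [ht]; simp)
      have hd := hdel y t ht htw
      have hc := Finset.card_erase_of_mem htw
      apply hAG
      refine quad hf b (Function.update η t (y + x)) ?_ (supp b f (w + y)) ?_ ?_ {t} ?_
        (w + y) w h2 hwS (repr_sum b _) ?_
      · intro i
        by_cases hi : i = t
        · subst hi
          rw [Function.update_self, map_add, hf.map_x, add_zero]
          exact supp_singleton.1 ht
        · rw [Function.update_of_ne hi, hηf]
      · rw [hd]; omega
      · intro i hi
        rw [hd, Finset.mem_erase] at hi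
        rw [Function.update_of_ne hi.1]
        exact ⟨hηS i, hηx i⟩
      · rintro j rfl
        refine ⟨by rw [hd]; simp, ?_⟩
        rw [Function.update_self]
        exact (mem_dd.1 h1).2
      · rw [Set.image_singleton, Function.update_self]
        have : w + y + w + x = (w + w) + (y + x) := by abel
        rw [this, dbl, zero_add]
        exact mem_span_singleton_self _
  have hw2 : ∀ w ∈ U, (supp b f w).card = 2 := by
    by_contra hcon
    push Not at hcon
    obtain ⟨w, hw, hw'⟩ := hcon
    have hsum := Finset.sum_card_bipartiteAbove_eq_sum_card_bipartiteBelow (s := dd S x) (t := U) R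
    have h1 := Finset.card_nsmul_le_sum (dd S x) (fun y => (Finset.bipartiteAbove R U y).card) _ hG
    have h2 : ∑ w ∈ U, (Finset.bipartiteBelow R (dd S x) w).card < ∑ w ∈ U, 4 :=
      Finset.sum_lt_sum (fun w hw => (hg4 w hw).1) ⟨w, hw, (hg4 w hw).2 hw'⟩
    rw [Finset.sum_const, smul_eq_mul] at h2
    rw [hYc, smul_eq_mul] at h1
    rw [hsum] at h1
    nlinarith
  have hUinj : Set.InjOn (supp b f) U := by
    intro w hw w' hw' he
    obtain ⟨hwS, h2⟩ := (mU w).1 hw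
    obtain ⟨hwS', h2'⟩ := (mU w').1 hw'
    rw [supp_eq_iff, hf.eq_iff] at he
    rcases he with he | he
    · exact he
    · exfalso
      obtain ⟨t, ht⟩ := hY1 w' (mem_dd.2 ⟨hwS', he ▸ hwS⟩)
      rw [ht] at h2'
      simp at h2'
  have himg : U.image (supp b f) = (Finset.univ : Finset (tt S x f)).powersetCard 2 := by
    apply Finset.eq_of_subset_of_card_le
    · intro I hI
      obtain ⟨w, hw, rfl⟩ := Finset.mem_image.1 hI
      exact Finset.mem_powersetCard.2 ⟨Finset.subset_univ _, hw2 w hw⟩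
    · rw [Finset.card_image_of_injOn hUinj, Finset.card_powersetCard, Finset.card_univ,
        Fintype.card_coe, htt, Nat.choose_two_right]
      omega
  have hpair : ∀ i j, i ≠ j → supp b f (η i + η j) = {i, j} := by
    intro i j hij
    ext s
    rw [mem_supp_add, supp_singleton.2 (hηf i), supp_singleton.2 (hηf j)]
    simp only [Finset.mem_singleton, Finset.mem_insert]
    constructor
    · intro h; tauto
    · rintro (rfl | rfl)
      · simp [hij]
      · simp [hij.symm]
  refine ⟨tt S x f, inferInstance, b, η, by rw [Fintype.card_coe, htt],
    fun i => ⟨hηf i, hηS i, hηx i⟩, ?_, ?_, ?_⟩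
  · intro i j hij
    have : ({i, j} : Finset (tt S x f)) ∈ U.image (supp b f) := by
      rw [himg, Finset.mem_powersetCard]
      exact ⟨Finset.subset_univ _, Finset.card_pair hij⟩
    obtain ⟨w, hw, he⟩ := Finset.mem_image.1 this
    rw [← hpair i j hij, supp_eq_iff, hf.eq_iff] at he
    rcases he with rfl | rfl
    · exact Or.inl ((mU _).1 hw).1
    · exact Or.inr ((mU _).1 hw).1
  · intro i j hij h1 h2
    obtain ⟨t, ht⟩ := hY1 _ (mem_dd.2 ⟨h1, h2⟩)
    rw [hpair i j hij] at ht
    have := Finset.card_pair hij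
    rw [ht] at this
    simp at this
  · intro s hs
    by_cases h0 : (supp b f s).card = 0
    · exact Or.inl (hY0 s hs (Finset.card_eq_zero.1 h0))
    right
    by_cases h1 : (supp b f s).card = 1
    · obtain ⟨t, ht⟩ := Finset.card_eq_one.1 h1
      rcases hsη s t ht with h | h
      · exact ⟨t, Or.inl h⟩
      · exact ⟨t, Or.inr (Or.inl h)⟩
    · obtain ⟨i, j, hij, he⟩ := Finset.card_eq_two.1 (hw2 s ((mU s).2 ⟨hs, by omega⟩))
      exact ⟨i, Or.inr (Or.inr ⟨j, hij, supp_pair hij he⟩)⟩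
end AGP

namespace AGP
universe u
set_option linter.unusedSectionVars false
open Submodule Module

variable {V W : Type u} [AddCommGroup V] [Module (ZMod 2) V] [AddCommGroup W] [Module (ZMod 2) W]

theorem wt_one_sum {ι : Type u} (b : Basis ι (ZMod 2) W) {p1 p2 p3 p4 : W}
    (h1 : p1 = 0 ∨ ∃ j, p1 = b j) (h2 : p2 = 0 ∨ ∃ j, p2 = b j) (h3 : p3 = 0 ∨ ∃ j, p3 = b j)
    (h4 : p4 = 0 ∨ ∃ j, p4 = b j) (n1 : p1 ≠ 0) (n2 : p1 ≠ p2) (n3 : p1 ≠ p3) (n4 : p1 ≠ p4)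
    (hs : p1 + p2 + p3 + p4 = 0) : False := by
  classical
  obtain ⟨j, hj⟩ := h1.resolve_left n1
  have key : ∀ p, (p = 0 ∨ ∃ j, p = b j) → p1 ≠ p → b.repr p j = 0 := by
    rintro p (rfl | ⟨k, rfl⟩) hne
    · simp
    · rw [b.repr_self, Finsupp.single_eq_of_ne]
      rintro rfl
      exact hne hj
  have h := congrArg (fun w => b.repr w j) hs
  simp only [map_add, Finsupp.add_apply, key p2 h2 n2, key p3 h3 n3, key p4 h4 n4] at h
  rw [hj, b.repr_self, Finsupp.single_eq_same] at h
  simp at h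

theorem star_nofano {ι : Type u} (b : Basis ι (ZMod 2) W) {T : Finset W}
    (hT : ∀ p ∈ T, ∃ i, p = b i ∨ ∃ j, i ≠ j ∧ p = b i + b j) (F : Submodule (ZMod 2) W)
    (hF : IsFano T F) : False := by
  classical
  have := hF.fin
  obtain ⟨a, haF, c, hcF, ha0, hc0, hac⟩ := exists_two (P := F) (by rw [hF.1]; norm_num)
  obtain ⟨i, hi⟩ : ∃ i, b.repr a i = 1 := by
    by_contra hcon
    push Not at hcon
    apply ha0
    apply b.repr.injective
    ext i
    rcases z2 (b.repr a i) with h | h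
    · rw [h]; simp
    · exact absurd h (hcon i)
  let K : Submodule (ZMod 2) W := (LinearMap.ker ((b.coord i).domRestrict F)).map F.subtype
  have hK : ∀ u, u ∈ K ↔ u ∈ F ∧ b.repr u i = 0 := by
    intro u
    simp only [K, Submodule.mem_map, LinearMap.mem_ker, LinearMap.domRestrict_apply,
      Submodule.subtype_apply, Basis.coord_apply]
    constructor
    · rintro ⟨y, hy, rfl⟩; exact ⟨y.2, hy⟩
    · rintro ⟨h1, h2⟩; exact ⟨⟨u, h1⟩, h2, rfl⟩
  have hKr : 2 ≤ finrank (ZMod 2) K := by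
    have h1 := LinearMap.finrank_range_add_finrank_ker ((b.coord i).domRestrict F)
    have h2 : finrank (ZMod 2) (LinearMap.range ((b.coord i).domRestrict F)) ≤ 1 := by
      have := Submodule.finrank_le (LinearMap.range ((b.coord i).domRestrict F))
      simpa using this
    have h3 : finrank (ZMod 2) K = finrank (ZMod 2) (LinearMap.ker ((b.coord i).domRestrict F)) :=
      (Submodule.equivMapOfInjective F.subtype F.injective_subtype _).finrank_eq.symm
    rw [hF.1] at h1
    omega
  obtain ⟨u, hu, v, hv, hu0, hv0, huv⟩ := exists_two hKr
  have huK := (hK u).1 hu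
  have hvK := (hK v).1 hv
  have key : ∀ q ∈ F, b.repr q i = 1 → (q + b i = 0 ∨ ∃ j, q + b i = b j) := by
    intro q hq hqi
    have hq0 : q ≠ 0 := by rintro rfl; simp at hqi
    obtain ⟨k, h | ⟨j, hkj, h⟩⟩ := hT q (hF.2 q hq hq0)
    · left
      have : k = i := by
        by_contra hne
        rw [h, b.repr_self, Finsupp.single_eq_of_ne (Ne.symm hne)] at hqi
        simp at hqi
      rw [h, this, dbl]
    · right
      by_cases hk : k = i
      · refine ⟨j, ?_⟩
        rw [h, hk, add_comm (b i), add_assoc, dbl, add_zero]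
      by_cases hj : j = i
      · refine ⟨k, ?_⟩
        rw [h, hj, add_assoc, dbl, add_zero]
      · exfalso
        rw [h, map_add, Finsupp.add_apply, b.repr_self, b.repr_self,
          Finsupp.single_eq_of_ne (Ne.symm hk), Finsupp.single_eq_of_ne (Ne.symm hj)] at hqi
        simp at hqi
  have k1 := key a haF hi
  have k2 := key (a + u) (add_mem haF huK.1) (by simp [hi, huK.2])
  have k3 := key (a + v) (add_mem haF hvK.1) (by simp [hi, hvK.2])
  have k4 := key (a + u + v) (add_mem (add_mem haF huK.1) hvK.1) (by simp [hi, huK.2, hvK.2])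
  have huv0 : u + v ≠ 0 := fun h => huv (add_eq_zero_iff'.1 h)
  have n12 : a + b i ≠ a + u + b i := by simpa using hu0
  have n13 : a + b i ≠ a + v + b i := by simpa using hv0
  have n14 : a + b i ≠ a + u + v + b i := by
    rw [add_assoc a u v]; simpa using huv0
  have n23 : a + u + b i ≠ a + v + b i := by simpa using huv
  have n24 : a + u + b i ≠ a + u + v + b i := by simpa using hv0
  have hsum : a + b i + (a + u + b i) + (a + v + b i) + (a + u + v + b i) = 0 := by
    have e : a + b i + (a + u + b i) + (a + v + b i) + (a + u + v + b i) =
      (a + a) + (a + a) + (u + u) + (v + v) + (b i + b i) + (b i + b i) := by abel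
    rw [e]; simp only [dbl, add_zero]
  by_cases h0 : a + b i = 0
  · refine wt_one_sum b k2 k1 k3 k4 ?_ n12.symm n23 n24 ?_
    · rw [← h0]; exact n12.symm
    · rw [← hsum]; abel
  · exact wt_one_sum b k1 k2 k3 k4 h0 n12 n13 n14 hsum

theorem fano_of_seven {T : Finset W} (h0 : (0 : W) ∉ T) {a b c : W} (h1 : a ∈ T) (h2 : b ∈ T)
    (h3 : c ∈ T) (h4 : a + b ∈ T) (h5 : a + c ∈ T) (h6 : b + c ∈ T) (h7 : a + b + c ∈ T) :
    IsFano T (span (ZMod 2) (Set.range ![a, b, c])) := by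
  have key : ∀ α β γ : ZMod 2, α • a + β • b + γ • c = 0 ∨ α • a + β • b + γ • c ∈ T := by
    intro α β γ
    rcases z2 α with rfl | rfl <;> rcases z2 β with rfl | rfl <;> rcases z2 γ with rfl | rfl <;>
      simp [*]
  have key' : ∀ α β γ : ZMod 2, α • a + β • b + γ • c ∉ T → α = 0 ∧ β = 0 ∧ γ = 0 := by
    intro α β γ
    rcases z2 α with rfl | rfl <;> rcases z2 β with rfl | rfl <;> rcases z2 γ with rfl | rfl <;>
      simp [*]
  constructor
  · have hli : LinearIndependent (ZMod 2) ![a, b, c] := by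
      rw [Fintype.linearIndependent_iff]
      intro g hg
      rw [Fin.sum_univ_three] at hg
      simp only [Matrix.cons_val] at hg
      obtain ⟨e1, e2, e3⟩ := key' _ _ _ (by rw [hg]; exact h0)
      intro i
      fin_cases i <;> assumption
    rw [finrank_span_eq_card hli]; simp
  · intro v hv hv0
    rw [Submodule.mem_span_range_iff_exists_fun] at hv
    obtain ⟨g, hg⟩ := hv
    rw [Fin.sum_univ_three] at hg
    simp only [Matrix.cons_val] at hg
    rcases key (g 0) (g 1) (g 2) with h | h
    · exact absurd (hg ▸ h) hv0
    · exact hg ▸ h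

theorem odd_fano {S : Finset V} {f : V →ₗ[ZMod 2] W} {x p q t : V}
    (hf : IsCon f (p + q))
    (hx : x ∈ S) (hp : p ∈ S) (hpx : p + x ∈ S) (ht : t ∈ S) (htx : t + x ∈ S) 
    (hpt : p + t ∈ S) (hqt : q + t + x ∈ S)
    (h0 : (0 : V) ∉ S) (hpq : p + q ∉ ({x, p, t, p + x, t + x, p + t} : Set V))
    (hptx : p ≠ t + x) :
    ∃ F, IsFano (con S f) F := by
  have hnz : ∀ s ∈ S, s ≠ p + q → f s ∈ con S f := by
    intro s hs hne
    refine mem_con.2 ⟨?_, s, hs, rfl⟩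
    rw [Ne, hf.ker]
    rintro (rfl | h)
    · exact h0 hs
    · exact hne h
  simp only [Set.mem_insert_iff, Set.mem_singleton_iff, not_or] at hpq
  obtain ⟨n1, n2, n3, n4, n5, n6⟩ := hpq
  refine ⟨_, fano_of_seven (zero_notMem_con S f) (a := f x) (b := f p) (c := f t)
    (hnz x hx (Ne.symm n1)) (hnz p hp (Ne.symm n2)) (hnz t ht (Ne.symm n3)) ?_ ?_ ?_ ?_⟩
  · rw [← map_add, add_comm]; exact hnz _ hpx (Ne.symm n4)
  · rw [← map_add, add_comm]; exact hnz _ htx (Ne.symm n5)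
  · rw [← map_add]; exact hnz _ hpt (Ne.symm n6)
  · have : f x + f p + f t = f (q + t + x) := by
      rw [← map_add, ← map_add, hf.eq_iff]
      right
      have e : q + t + x + (p + q) = x + p + t + (q + q) := by abel
      rw [e, dbl, add_zero]
    rw [this]
    refine hnz _ hqt ?_
    intro h
    apply hptx
    have e : q + (t + x) = q + p := by rw [← add_assoc, h, add_comm]
    exact (add_left_cancel e).symm

theorem no_fano_con {n : ℕ} (hn : 5 ≤ n) {S : Finset V} (h0 : (0 : V) ∉ S)
    (hAG : ¬ HasAG (S : Set V)) (hspan : span (ZMod 2) (S : Set V) = ⊤)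
    (hrk : rk S = n + 1) (hcard : 2 * S.card = (n + 1) * (n + 2))
    {f : V →ₗ[ZMod 2] W} {x : V} (hf : IsCon f x) (hx : x ∈ S)
    (hxF : ∀ F, IsFano S F → x ∉ F) (F : Submodule (ZMod 2) W) (hF : IsFano (con S f) F) :
    False := by
  obtain ⟨ι, _, b, η, -, h1, -, -, h4⟩ := STR hn h0 hAG hspan hrk hcard hf hx hxF
  refine star_nofano b ?_ F hF
  intro p hp
  obtain ⟨hp0, s, hs, rfl⟩ := mem_con.1 hp
  rcases h4 s hs with rfl | ⟨i, rfl | rfl | ⟨j, hij, h⟩⟩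
  · exact absurd hf.map_x hp0
  · exact ⟨i, Or.inl (h1 i).1⟩
  · refine ⟨i, Or.inl ?_⟩
    rw [map_add, hf.map_x, add_zero]; exact (h1 i).1
  · exact ⟨i, Or.inr ⟨j, hij, h⟩⟩

theorem frame {n : ℕ} (hn : 5 ≤ n) {S : Finset V} (h0 : (0 : V) ∉ S)
    (hAG : ¬ HasAG (S : Set V)) (hspan : span (ZMod 2) (S : Set V) = ⊤)
    (hrk : rk S = n + 1) (hcard : 2 * S.card = (n + 1) * (n + 2)) :
    ∃ (ι : Type u) (_ : Fintype ι) (x : V) (y : ι → V), Fintype.card ι = n ∧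
      LinearIndependent (ZMod 2) y ∧ x ∉ span (ZMod 2) (Set.range y) ∧
      x ∈ S ∧ (∀ i, y i ∈ S ∧ y i + x ∈ S) ∧ (∀ i j, i ≠ j → y i + y j ∈ S) ∧
      ∀ s ∈ S, s = x ∨ ∃ i, s = y i ∨ s = y i + x ∨ ∃ j, i ≠ j ∧ s = y i + y j := by
  classical
  have hone : ∀ F F', IsFano S F → IsFano S F' → F = F' := by
    intro F F' hF hF'
    by_contra hne
    have := (two_fano_lt (fun k _ => bound_all k) h0 hAG hrk hF hF' hne).2
    exact absurd hcard (Nat.ne_of_lt this)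
  obtain ⟨x, hx, hxF⟩ := exists_nonfano hone (by omega)
  have hx0 : x ≠ 0 := fun h => h0 (h ▸ hx)
  have hf := isCon_mkQ x hx0
  have hnoF : ∀ F, ¬ IsFano S F := by
    intro F hF
    exact no_fano_con hn h0 hAG hspan hrk hcard hf hx hxF _ (hF.con hf (hxF F hF))
  obtain ⟨ι, hfin, b, η, hc, h1, h2, h3, h4⟩ := STR hn h0 hAG hspan hrk hcard hf hx hxF
  generalize (span (ZMod 2) {x}).mkQ = f at *
  have : Nonempty ι := Fintype.card_pos_iff.1 (by omega)
  obtain ⟨i0⟩ := this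
  let y : ι → V := fun i => if i = i0 ∨ η i0 + η i ∈ S then η i else η i + x
  have hxx : ∀ v : V, v + x + x = v := fun v => by rw [add_assoc, dbl, add_zero]
  have hy : ∀ i, y i = η i ∨ y i = η i + x := by
    intro i
    by_cases h : i = i0 ∨ η i0 + η i ∈ S
    · left; simp only [y, if_pos h]
    · right; simp only [y, if_neg h]
  have hyb : ∀ i, f (y i) = b i := by
    intro i
    rcases hy i with h | h
    · rw [h, (h1 i).1]
    · rw [h, map_add, hf.map_x, add_zero, (h1 i).1]
  have hyS : ∀ i, y i ∈ S ∧ y i + x ∈ S := by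
    intro i
    rcases hy i with h | h
    · rw [h]; exact (h1 i).2
    · rw [h, hxx]; exact (h1 i).2.symm
  have hsum : ∀ i j, y i + y j = η i + η j ∨ y i + y j = η i + η j + x := by
    intro i j
    rw [← hf.eq_iff, map_add, map_add, hyb, hyb, (h1 i).1, (h1 j).1]
  have hor : ∀ i j, i ≠ j → y i + y j ∈ S ∨ y i + y j + x ∈ S := by
    intro i j hij
    rcases hsum i j with h | h
    · rw [h]; exact h2 i j hij
    · rw [h, hxx]; exact (h2 i j hij).symm
  have hand : ∀ i j, i ≠ j → y i + y j ∈ S → y i + y j + x ∈ S → False := by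
    intro i j hij
    rcases hsum i j with h | h
    · rw [h]; exact h3 i j hij
    · rw [h, hxx]; exact fun a b => h3 i j hij b a
  have hbase : ∀ j, j ≠ i0 → y i0 + y j ∈ S := by
    intro j hj
    have e0 : y i0 = η i0 := by simp [y]
    rw [e0]
    by_cases h : η i0 + η j ∈ S
    · simp only [y, hj, h, or_true, if_true]
    · simp only [y, hj, h, or_self, if_false]
      rw [← add_assoc]
      exact (h2 i0 j hj.symm).resolve_left h
  have hall : ∀ i j, i ≠ j → y i + y j ∈ S := by
    intro i j hij
    by_cases hi : i = i0
    · subst hi; exact hbase j hij.symm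
    by_cases hj : j = i0
    · subst hj; rw [add_comm]; exact hbase i hij
    by_contra hcon
    have hodd := (hor i j hij).resolve_left hcon
    have hpS := hbase i hi
    have hf' := isCon_mkQ (y i0 + y i) (fun h => h0 (h ▸ hpS))
    have bne : ∀ k, b k ≠ 0 := fun k => b.ne_zero k
    have binj : ∀ k l, b k = b l → k = l := fun k l h => b.injective h
    have n1 : b i0 ≠ b i := fun h => hi (binj _ _ h).symm
    have n2 : b i0 ≠ b j := fun h => hj (binj _ _ h).symm
    have n3 : b i ≠ b j := fun h => hij (binj _ _ h)
    have n4 : b i0 + b i ≠ b j := by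
      intro h
      have := congrArg (fun w => b.repr w j) h
      simp only [map_add, Finsupp.add_apply, b.repr_self, Finsupp.single_eq_same,
        Finsupp.single_eq_of_ne hij.symm, Finsupp.single_eq_of_ne hj] at this
      simp at this
    obtain ⟨F, hF⟩ := odd_fano (x := x) (t := y j) hf' hx (hyS i0).1 (hyS i0).2 (hyS j).1 (hyS j).2
      (hbase j hj) hodd h0 (by
        simp only [Set.mem_insert_iff, Set.mem_singleton_iff, not_or]
        refine ⟨fun h => ?_, fun h => ?_, fun h => ?_, fun h => ?_, fun h => ?_, fun h => ?_⟩ <;>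
          replace h := congrArg f h <;> simp only [map_add, hyb, hf.map_x, add_zero] at h
        · exact n1 (add_eq_zero_iff'.1 h)
        · exact bne i (by simpa using h)
        · exact n4 h
        · exact bne i (by simpa using h)
        · exact n4 h
        · exact n3 (add_left_cancel h)) (fun h => by
          replace h := congrArg f h
          simp only [map_add, hyb, hf.map_x, add_zero] at h
          exact n2 h)
    exact no_fano_con hn h0 hAG hspan hrk hcard hf' hpS (fun F hF => absurd hF (hnoF F)) F hF
  have hfy : f ∘ y = b := funext hyb
  have hli : LinearIndependent (ZMod 2) (f ∘ y) := hfy ▸ b.linearIndependent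
  refine ⟨ι, hfin, x, y, hc, hli.of_comp, ?_, hx, hyS, hall, ?_⟩
  · intro hxs
    rw [Submodule.mem_span_range_iff_exists_fun] at hxs
    obtain ⟨c, hcx⟩ := hxs
    have h := congrArg f hcx
    rw [hf.map_x, map_sum] at h
    simp only [map_smul] at h
    have hz := Fintype.linearIndependent_iff.1 hli c h
    apply hx0
    rw [← hcx]
    exact Finset.sum_eq_zero (fun i _ => by rw [hz i, zero_smul])
  · intro s hs
    rcases h4 s hs with h | ⟨i, h⟩
    · exact Or.inl h
    right
    have case1 : f s = b i → s = y i ∨ s = y i + x := by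
      intro h
      rwa [← hyb, hf.eq_iff] at h
    rcases h with h | h | ⟨j, hij, h⟩
    · exact ⟨i, by rcases case1 (by rw [h, (h1 i).1]) with h | h <;> simp [h]⟩
    · exact ⟨i, by
        rcases case1 (by rw [h, map_add, hf.map_x, add_zero, (h1 i).1]) with h | h <;> simp [h]⟩
    · refine ⟨i, Or.inr (Or.inr ⟨j, hij, ?_⟩)⟩
      rw [← hyb i, ← hyb j, ← map_add, hf.eq_iff] at h
      rcases h with h | h
      · exact h
      · exact absurd (h ▸ hs) (fun h' => hand i j hij (hall i j hij) h')

theorem vec_top {n : ℕ} (hn : 5 ≤ n) {S : Finset V} (h0 : (0 : V) ∉ S)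
    (hAG : ¬ HasAG (S : Set V)) (hspan : span (ZMod 2) (S : Set V) = ⊤)
    (hrk : rk S = n + 1) (hcard : 2 * S.card = (n + 1) * (n + 2)) :
    ∃ g : V →ₗ[ZMod 2] (Fin (n + 2) → ZMod 2), Function.Injective g ∧
      Set.BijOn g S {z | ∃ i j : Fin (n + 2), i ≠ j ∧ z = Pi.single i 1 + Pi.single j 1} := by
  classical
  obtain ⟨ι, _, x, y0, hc, hli, hx, hxS, hyS, hpS, hall⟩ := frame hn h0 hAG hspan hrk hcard
  let e : Fin n ≃ ι := (Fintype.equivFinOfCardEq hc).symm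
  let v : Fin (n + 1) → V := Fin.cons x (y0 ∘ e)
  have v0 : v 0 = x := rfl
  have vs : ∀ i, v i.succ = y0 (e i) := fun i => rfl
  have hv : LinearIndependent (ZMod 2) v := by
    rw [linearIndependent_finCons]
    refine ⟨hli.comp e e.injective, ?_⟩
    rw [Set.range_comp, e.range_eq_univ, Set.image_univ]
    exact hx
  have hfr : finrank (ZMod 2) V = n + 1 := by
    rw [rk, hspan, finrank_top] at hrk; exact hrk
  let B : Basis (Fin (n + 1)) (ZMod 2) V :=
    basisOfLinearIndependentOfCardEqFinrank hv (by simp [hfr])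
  have hB : ∀ i, B i = v i := fun i => by simp [B]
  let g : V →ₗ[ZMod 2] (Fin (n + 2) → ZMod 2) :=
    B.constr (ZMod 2) (fun i => Pi.single 0 1 + Pi.single i.succ 1)
  have hg : ∀ i, g (v i) = Pi.single 0 1 + Pi.single i.succ 1 := fun i => by
    rw [← hB]; exact B.constr_basis _ _ _
  have hg2 : ∀ i j, g (v i + v j) = Pi.single i.succ 1 + Pi.single j.succ 1 := by
    intro i j
    rw [map_add, hg, hg]
    have e : ∀ p q t : Fin (n + 2) → ZMod 2, p + q + (p + t) = (p + p) + (q + t) :=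
      fun p q t => by abel
    rw [e, dbl, zero_add]
  have hproj : ∀ i w, g w i.succ = B.repr w i := by
    intro i w
    have : (LinearMap.proj i.succ : (Fin (n + 2) → ZMod 2) →ₗ[ZMod 2] ZMod 2).comp g = B.coord i := by
      apply B.ext
      intro j
      rw [LinearMap.comp_apply, hB, hg, Basis.coord_apply, ← hB, B.repr_self, Finsupp.single_apply]
      have e0 : (Pi.single 0 1 : Fin (n + 2) → ZMod 2) i.succ = 0 :=
        Pi.single_eq_of_ne (Fin.succ_ne_zero i) 1
      rw [LinearMap.proj_apply, Pi.add_apply, e0, zero_add, Pi.single_apply]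
      by_cases hij : j = i
      · rw [if_pos hij, if_pos (by rw [hij])]
      · rw [if_neg hij, if_neg (fun h => hij (Fin.succ_injective _ h).symm)]
    exact LinearMap.congr_fun this w
  have hinj : Function.Injective g := by
    intro w w' h
    apply B.repr.injective
    ext i
    rw [← hproj, ← hproj, h]
  have hv1 : ∀ i, v i ∈ S := by
    intro i
    refine Fin.cases ?_ (fun i => ?_) i
    · exact hxS
    · exact (hyS _).1
  have hv2 : ∀ i j, i ≠ j → v i + v j ∈ S := by
    intro i j
    refine Fin.cases ?_ (fun i => ?_) i <;> refine Fin.cases ?_ (fun j => ?_) j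
    · intro h; exact absurd rfl h
    · intro _; rw [v0, vs, add_comm]; exact (hyS _).2
    · intro _; rw [v0, vs]; exact (hyS _).2
    · intro h
      exact hpS _ _ (fun h' => h (congrArg _ (e.injective h')))
  refine ⟨g, hinj, ?_, hinj.injOn, ?_⟩
  · have m1 : ∀ i, g (v i) ∈ {z : Fin (n + 2) → ZMod 2 | ∃ i j : Fin (n + 2), i ≠ j ∧
        z = Pi.single i 1 + Pi.single j 1} := fun i =>
      ⟨0, i.succ, (Fin.succ_ne_zero i).symm, hg i⟩
    have m2 : ∀ i j, i ≠ j → g (v i + v j) ∈ {z : Fin (n + 2) → ZMod 2 | ∃ i j : Fin (n + 2), i ≠ j ∧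
        z = Pi.single i 1 + Pi.single j 1} := fun i j hij =>
      ⟨i.succ, j.succ, fun h => hij (Fin.succ_injective _ h), hg2 i j⟩
    have ve : ∀ i, y0 i = v (e.symm i).succ := fun i => by rw [vs, e.apply_symm_apply]
    intro s hs
    rcases hall s hs with rfl | ⟨i, rfl | rfl | ⟨j, hij, rfl⟩⟩
    · exact m1 0
    · rw [ve]; exact m1 _
    · rw [ve, ← v0]; exact m2 _ _ (Fin.succ_ne_zero _)
    · rw [ve, ve j]
      exact m2 _ _ (fun h => hij (e.symm.injective (Fin.succ_injective _ h)))
  · rintro z ⟨i, j, hij, rfl⟩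
    revert hij
    refine Fin.cases ?_ (fun i => ?_) i <;> refine Fin.cases ?_ (fun j => ?_) j
    · intro h; exact absurd rfl h
    · intro _; exact ⟨v j, hv1 j, hg j⟩
    · intro _; exact ⟨v i, hv1 i, (hg i).trans (add_comm _ _)⟩
    · intro h
      exact ⟨v i + v j, hv2 i j (fun h' => h (congrArg _ h')), hg2 i j⟩

theorem vec_main {n : ℕ} (hn : 5 ≤ n) {S : Finset V} (h0 : (0 : V) ∉ S)
    (hAG : ¬ HasAG (S : Set V))
    (hrk : rk S = n + 1) (hcard : 2 * S.card = (n + 1) * (n + 2)) :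
    ∃ g : V →ₗ[ZMod 2] (Fin (n + 2) → ZMod 2),
      Disjoint (span (ZMod 2) (S : Set V)) (LinearMap.ker g) ∧
      Set.BijOn g S {z | ∃ i j : Fin (n + 2), i ≠ j ∧ z = Pi.single i 1 + Pi.single j 1} := by
  classical
  set P := span (ZMod 2) (S : Set V) with hP
  obtain ⟨pr, hpr⟩ := P.subtype.exists_leftInverse_of_injective P.ker_subtype
  have hprP : ∀ v (hv : v ∈ P), pr v = ⟨v, hv⟩ := fun v hv => LinearMap.congr_fun hpr ⟨v, hv⟩
  have hSP : ∀ s ∈ S, s ∈ P := fun s hs => subset_span hs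
  let T : Finset P := S.image pr
  have mT : ∀ p : P, p ∈ T ↔ (p : V) ∈ S := by
    intro p
    simp only [T, Finset.mem_image]
    constructor
    · rintro ⟨s, hs, rfl⟩
      rw [hprP s (hSP s hs)]; exact hs
    · intro h; exact ⟨p, h, hprP _ p.2⟩
  have hTS : P.subtype '' (T : Set P) = S := by
    ext s
    constructor
    · rintro ⟨p, hp, rfl⟩; exact (mT p).1 hp
    · intro hs; exact ⟨⟨s, hSP s hs⟩, (mT _).2 hs, rfl⟩
  have hTspan : span (ZMod 2) (T : Set P) = ⊤ := by
    apply Submodule.map_injective_of_injective P.injective_subtype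
    rw [Submodule.map_span, hTS, Submodule.map_top, Submodule.range_subtype]
  have hTc : T.card = S.card := by
    apply Finset.card_image_of_injOn
    intro s hs s' hs' h
    rw [hprP s (hSP s hs), hprP s' (hSP s' hs')] at h
    exact congrArg Subtype.val h
  obtain ⟨g, hg, hbij⟩ := vec_top hn (S := T) (fun h => h0 ((mT 0).1 h))
    (fun h => hAG (hTS ▸ h.map_inj _ P.injective_subtype)) hTspan
    (by rw [rk, hTspan, finrank_top]; exact hrk) (by rw [hTc]; exact hcard)
  refine ⟨g.comp pr, ?_, ?_⟩
  · rw [Submodule.disjoint_def]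
    intro v hv hk
    rw [LinearMap.mem_ker, LinearMap.comp_apply, hprP v hv] at hk
    have := hg (hk.trans (map_zero g).symm)
    exact congrArg Subtype.val this
  · have : Set.BijOn pr (S : Set V) (T : Set P) := by
      refine ⟨fun s hs => Finset.mem_image_of_mem _ hs, ?_, ?_⟩
      · intro s hs s' hs' h
        rw [hprP s (hSP s hs), hprP s' (hSP s' hs')] at h
        exact congrArg Subtype.val h
      · intro p hp
        exact ⟨p, (mT p).1 hp, hprP _ p.2⟩
    exact hbij.comp this
end AGP

namespace AGP
open Submodule Module

section
universe v
variable {β : Type v} {V : Type} [AddCommGroup V] [Module (ZMod 2) V]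

theorem indep_iff {M : Matroid β} {φ : β → V} (h : M.IsRepBy (ZMod 2) φ) {I : Set β} (hI : I ⊆ M.E) :
    M.Indep I ↔ LinearIndepOn (ZMod 2) φ I := h I hI

theorem simple_inj {M : Matroid β} {φ : β → V} (h : M.IsRepBy (ZMod 2) φ) (hs : M.IsSimpleM) :
    Set.InjOn φ M.E := by
  intro e he f hf hef
  have h1 := (indep_iff h (I := {e, f}) (by rintro x (rfl | rfl) <;> assumption)).1 (hs e he f hf)
  exact h1.injOn (by simp) (by simp) hef

theorem simple_ne {M : Matroid β} {φ : β → V} (h : M.IsRepBy (ZMod 2) φ) (hs : M.IsSimpleM)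
    {e : β} (he : e ∈ M.E) : φ e ≠ 0 := by
  have h1 := (indep_iff h (I := {e, e}) (by rintro x (rfl | rfl) <;> assumption)).1 (hs e he e he)
  exact h1.ne_zero (by simp)

theorem ncard_span {φ : β → V} {I : Set β} (hfin : I.Finite) (h : LinearIndepOn (ZMod 2) φ I) :
    finrank (ZMod 2) (span (ZMod 2) (φ '' I)) = I.ncard := by
  have : Fintype I := hfin.fintype
  have h1 := finrank_span_eq_card (b := fun i : I => φ i) h
  rw [Set.image_eq_range, h1, ← Nat.card_eq_fintype_card]
  rfl

theorem rk_eq {M : Matroid β} {φ : β → V} (h : M.IsRepBy (ZMod 2) φ) {S : Finset V}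
    (hfin : M.E.Finite) (hS : (S : Set V) = φ '' M.E) : M.rkM = rk S := by
  have : FiniteDimensional (ZMod 2) (span (ZMod 2) (S : Set V)) :=
    FiniteDimensional.span_of_finite _ (Set.toFinite _)
  apply IsGreatest.csSup_eq
  constructor
  · obtain ⟨I, hI, -, hsp, hli⟩ := exists_linearIndepOn_extension
      (linearIndepOn_empty (ZMod 2) φ) (Set.empty_subset M.E)
    refine ⟨I, hI, (indep_iff h hI).2 hli, ?_⟩
    have hsp' : span (ZMod 2) (φ '' I) = span (ZMod 2) (φ '' M.E) :=
      le_antisymm (span_mono (image_mono hI)) (span_le.2 hsp)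
    rw [← ncard_span (hfin.subset hI) hli, rk, hS, hsp']
  · rintro n ⟨I, hI, hind, rfl⟩
    rw [← ncard_span (hfin.subset hI) ((indep_iff h hI).1 hind), rk]
    apply Submodule.finrank_mono
    rw [hS]
    exact span_mono (image_mono hI)

theorem minor_of_HasAG {M : Matroid β} {φ : β → V} (h : M.IsRepBy (ZMod 2) φ)
    (hAG : HasAG (φ '' M.E)) : M.HasAGMinor := by
  classical
  obtain ⟨C, a, b, c, d, hC, hind, hpts⟩ := hAG
  let C' := {e | e ∈ M.E ∧ φ e ∈ C}
  have hC'E : C' ⊆ M.E := fun e he => he.1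
  have hC' : φ '' C' = C := by
    ext s
    constructor
    · rintro ⟨e, he, rfl⟩; exact he.2
    · intro hs
      obtain ⟨e, he, rfl⟩ := hC hs
      exact ⟨e, ⟨he, hs⟩, rfl⟩
  let g0 : (Fin 4 → ZMod 2) → V := fun v => v 0 • a + v 1 • b + v 2 • c + v 3 • d
  have hp : ∀ v : agVecs, ∃ e ∈ M.E, φ e + g0 v ∈ span (ZMod 2) C := by
    intro v
    obtain ⟨s, ⟨e, he, rfl⟩, hs⟩ := hpts (v.1 1) (v.1 2) (v.1 3)
    refine ⟨e, he, ?_⟩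
    have hv : v.1 0 = 1 := v.2
    simp only [g0, hv, one_smul]
    exact hs
  choose e heE he using hp
  let g : (Fin 4 → ZMod 2) →ₗ[ZMod 2] V :=
    { toFun := g0
      map_add' := fun u v => by simp only [g0, Pi.add_apply]; module
      map_smul' := fun k v => by
        simp only [g0, Pi.smul_apply, smul_eq_mul, RingHom.id_apply]; module }
  have hg : ∀ v, g v = g0 v := fun v => rfl
  obtain ⟨I0, hI0⟩ := M.exists_isBasis' C'
  have hI0C : I0 ⊆ C' := hI0.subset
  have hI0li : LinearIndepOn (ZMod 2) φ I0 := (indep_iff h (hI0C.trans hC'E)).1 hI0.indep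
  have hspan : span (ZMod 2) (φ '' I0) = span (ZMod 2) C := by
    apply le_antisymm
    · rw [← hC']; exact span_mono (image_mono hI0C)
    · rw [← hC', span_le]
      obtain ⟨I1, h1, h2, h3, h4⟩ := exists_linearIndepOn_extension hI0li hI0C
      have : I1 = I0 := (hI0.eq_of_subset_indep ((indep_iff h (h1.trans hC'E)).2 h4) h2 h1).symm
      rw [this] at h3
      exact h3
  let G := (span (ZMod 2) C).mkQ.comp g
  have hGinj : Function.Injective G := by
    rw [← LinearMap.ker_eq_bot, LinearMap.ker_eq_bot']
    intro v hv
    rw [LinearMap.comp_apply, mkQ_apply, Submodule.Quotient.mk_eq_zero] at hv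
    obtain ⟨h1, h2, h3, h4⟩ := hind _ _ _ _ hv
    ext i
    fin_cases i <;> assumption
  have hGe : ∀ v : agVecs, (span (ZMod 2) C).mkQ (φ (e v)) = G v := by
    intro v
    rw [← add_eq_zero_iff', LinearMap.comp_apply, ← map_add, mkQ_apply,
      Submodule.Quotient.mk_eq_zero]
    exact he v
  have heinj : Function.Injective e := by
    intro v w hvw
    apply Subtype.ext
    apply hGinj
    rw [← hGe, ← hGe, hvw]
  have heC : ∀ v, e v ∉ C' := by
    intro v hv
    have h1 : (span (ZMod 2) C).mkQ (φ (e v)) = 0 := by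
      rw [mkQ_apply, Submodule.Quotient.mk_eq_zero]; exact subset_span hv.2
    rw [hGe] at h1
    have h2 := hGinj (h1.trans (map_zero G).symm)
    have h3 : v.1 0 = 1 := v.2
    rw [h2] at h3
    simp at h3
  let ψ : β → (Fin 4 → ZMod 2) := Function.extend e Subtype.val 0
  have hψ : ∀ v, ψ (e v) = v := fun v => heinj.extend_apply _ _ _
  have hNE : ((M.con C').del (Set.range e)ᶜ).E = Set.range e := by
    change (M.E \ C') \ (Set.range e)ᶜ = _
    ext x
    constructor
    · rintro ⟨-, hx⟩; simpa using hx
    · rintro ⟨v, rfl⟩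
      exact ⟨⟨heE v, heC v⟩, by simp⟩
  refine ⟨(M.con C').del (Set.range e)ᶜ, ⟨C', _, rfl⟩, ψ, ?_, ?_⟩
  · intro I hI
    have hI' := hI
    rw [hNE] at hI'
    have hdis : Disjoint C' I := by
      rw [Set.disjoint_left]
      intro x hx hx'
      obtain ⟨v, rfl⟩ := hI' hx'
      exact heC v hx
    have hIE : I ⊆ M.E := by
      intro x hx
      obtain ⟨v, rfl⟩ := hI' hx
      exact heE v
    have e1 : ((M.con C').del (Set.range e)ᶜ).Indep I ↔ (M ／ C').Indep I := by
      change ((M ／ C') ↾ _).Indep I ↔ _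
      rw [Matroid.restrict_indep_iff]
      exact and_iff_left hI
    rw [e1, hI0.contract_indep_iff, and_iff_left hdis,
      indep_iff h (Set.union_subset hIE (hI0C.trans hC'E)), Set.union_comm,
      linearIndepOn_union_iff_quotient (hdis.mono_left hI0C), and_iff_right hI0li, hspan]
    rw [linearIndepOn_congr (w := G ∘ ψ)]
    · exact G.linearIndepOn_iff_of_injOn hGinj.injOn
    · intro x hx
      obtain ⟨v, rfl⟩ := hI' hx
      simp only [Function.comp_apply, hψ]
      exact hGe v
  · rw [hNE]
    refine ⟨?_, ?_, ?_⟩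
    · rintro x ⟨v, rfl⟩
      rw [hψ]; exact v.2
    · rintro x ⟨v, rfl⟩ y ⟨w, rfl⟩ hxy
      rw [hψ, hψ] at hxy
      rw [Subtype.ext hxy]
    · intro v hv
      exact ⟨e ⟨v, hv⟩, ⟨_, rfl⟩, hψ _⟩
end
end AGP

theorem max_size_no_AG32_unique {α : Type*} (M : Matroid α) (r : ℕ) (hr : 6 ≤ r)
    (hbin : M.IsBinaryM) (hsimple : M.IsSimpleM) (hrank : M.rkM = r)
    (hAG : ¬ M.HasAGMinor) (hsize : M.E.ncard = (r + 1).choose 2) :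
    M.IsBinaryIsoTo (kVecs (r + 1)) := by
  classical
  obtain ⟨m, φ, hφ⟩ := hbin
  have hfin : M.E.Finite := by
    apply Set.finite_of_ncard_pos
    rw [hsize]
    exact Nat.choose_pos (by omega)
  have hinj := AGP.simple_inj hφ hsimple
  let S : Finset (Fin m → ZMod 2) := hfin.toFinset.image φ
  have hS : (S : Set (Fin m → ZMod 2)) = φ '' M.E := by simp [S]
  have h0 : (0 : Fin m → ZMod 2) ∉ S := by
    rw [← Finset.mem_coe, hS]
    rintro ⟨e, he, h⟩
    exact AGP.simple_ne hφ hsimple he h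
  have hAG' : ¬ AGP.HasAG (S : Set (Fin m → ZMod 2)) := fun h =>
    hAG (AGP.minor_of_HasAG hφ (hS ▸ h))
  have hrk : AGP.rk S = r := by rw [← AGP.rk_eq hφ hfin hS, hrank]
  have hcard : S.card = (r + 1).choose 2 := by
    rw [← hsize, ← Set.ncard_coe_finset, hS, Set.ncard_image_of_injOn hinj]
  obtain ⟨n, rfl⟩ : ∃ n, r = n + 1 := ⟨r - 1, by omega⟩
  have hcard2 : 2 * S.card = (n + 1) * (n + 2) := by
    rw [hcard, Nat.choose_two_right, Nat.mul_div_cancel' (Nat.even_mul_pred_self _).two_dvd]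
    simp only [Nat.add_sub_cancel]
    ring
  obtain ⟨g, hg, hbij⟩ := AGP.vec_main (by omega) h0 hAG' hrk hcard2
  refine ⟨g ∘ φ, ?_, ?_⟩
  · intro I hI
    rw [hφ I hI]
    refine (g.linearIndepOn_iff_of_injOn (v := φ) (s := I) ?_).symm
    refine LinearMap.injOn_of_disjoint_ker ?_ hg
    apply Submodule.span_mono
    rw [hS]
    exact Set.image_mono hI
  · refine Set.BijOn.comp ?_ (hinj.bijOn_image)
    rw [← hS]
    exact hbij
end

section
/- Let x be an element of a simple binary matroid M. Assume that C is a circuit of size 4 in some minor of M/x, and that every element of C lies in a parallel pair (a 2-element circuit) of M/x. Then M has an AG(3,2)-minor. -/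
open Matroid Set

variable {α : Type*}

/-- Over `ZMod 2`, a minimally dependent finite family sums to zero. -/
theorem sum_eq_zero_of_min_dep {β V : Type*} [DecidableEq β] [AddCommGroup V] [Module (ZMod 2) V]
    (v : β → V) (S : Finset β) (hdep : ¬ LinearIndepOn (ZMod 2) v (S : Set β))
    (hmin : ∀ i ∈ S, LinearIndepOn (ZMod 2) v ((S.erase i : Finset β) : Set β)) :
    ∑ i ∈ S, v i = 0 := by
  obtain ⟨f, hf, i, hi, hfi⟩ := not_linearIndepOn_finset_iff.1 hdep
  have h2 : ∀ a : ZMod 2, a ≠ 0 → a = 1 := by decide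
  have hall : ∀ j ∈ S, f j = 1 := by
    intro j hj
    refine h2 _ fun h0 => hfi ?_
    have hne : i ≠ j := fun h => hfi (h ▸ h0)
    refine linearIndepOn_finset_iff.1 (hmin j hj) f ?_ i (Finset.mem_erase.2 ⟨hne, hi⟩)
    rw [← hf, ← Finset.add_sum_erase S _ hj, h0, zero_smul, zero_add]
  rw [← hf]
  exact Finset.sum_congr rfl fun j hj => by rw [hall j hj, one_smul]

theorem zmod_two_aux : ∀ a b e : ZMod 2, a + (b + e) = 0 → b = a + e := by decide

/-- Coordinates of the eight points. -/
def cubeVec (s : ZMod 2) (p : Fin 4 × ZMod 2) : Fin 4 → ZMod 2 :=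
  match p.1 with
  | 0 => ![1, p.2, 0, 0]
  | 1 => ![1, p.2, 1, 0]
  | 2 => ![1, p.2, 0, 1]
  | 3 => ![1, p.2 + s, 1, 1]

theorem cubeVec_inj (s : ZMod 2) : Function.Injective (cubeVec s) := by
  revert s; unfold Function.Injective; decide

theorem cubeVec_mem (s : ZMod 2) (p) : cubeVec s p 0 = 1 := by
  revert s p; decide

theorem cubeVec_surj (s : ZMod 2) : ∀ y : Fin 4 → ZMod 2, y 0 = 1 → ∃ p, cubeVec s p = y := by
  revert s; decide

theorem cubeVec_repr {W : Type*} [AddCommGroup W] [Module (ZMod 2) W]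
    (c : Fin 4 → W) (x : W) (s : ZMod 2)
    (hli : ∀ a : Fin 4 → ZMod 2, a 0 • c 0 + a 1 • c 1 + a 2 • c 2 + a 3 • x = 0 → a = 0)
    (hsum : c 0 + c 1 + c 2 + c 3 = s • x) :
    ∃ P : (Fin 4 → ZMod 2) →ₗ[ZMod 2] W, Function.Injective P ∧
      ∀ p, P (cubeVec s p) = c p.1 + p.2 • x := by
  have hW : ∀ w : W, w + w = 0 := fun w => by
    have : (2 : ZMod 2) • w = 0 := by rw [show (2 : ZMod 2) = 0 from rfl, zero_smul]
    rwa [two_smul] at this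
  have hneg : ∀ w : W, -w = w := fun w => neg_eq_of_add_eq_zero_left (hW w)
  refine ⟨Fintype.linearCombination (ZMod 2) ![c 0, x, c 0 + c 1, c 0 + c 2], ?_, ?_⟩
  · rw [injective_iff_map_eq_zero]
    intro y hy
    simp only [Fintype.linearCombination_apply, Fin.sum_univ_four] at hy
    have := hli ![y 0 + y 2 + y 3, y 2, y 3, y 1] (by
      rw [← hy]; simp; module)
    have h0 := congrFun this 0
    have h1 := congrFun this 1
    have h2 := congrFun this 2
    have h3 := congrFun this 3
    simp at h0 h1 h2 h3
    ext i; fin_cases i <;> simp_all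
  · rintro ⟨i, b⟩
    have h3 : c 3 = c 0 + c 1 + c 2 + s • x := by
      rw [← hsum]
      have h0 := hW (c 0 + c 1 + c 2)
      rw [← add_assoc, h0, zero_add]
    fin_cases i
    · simp [Fintype.linearCombination_apply, Fin.sum_univ_four, cubeVec]
    · simp [Fintype.linearCombination_apply, Fin.sum_univ_four, cubeVec]
      have := hW (c 0)
      linear_combination (norm := module) (1 : ℤ) • this
    · simp [Fintype.linearCombination_apply, Fin.sum_univ_four, cubeVec]
      have := hW (c 0)
      linear_combination (norm := module) (1 : ℤ) • this
    · simp [Fintype.linearCombination_apply, Fin.sum_univ_four, cubeVec, h3, add_smul]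
      have := hW (c 0)
      linear_combination (norm := module) (1 : ℤ) • this

theorem lifting_circuit {α : Type*} (M : Matroid α) (hbin : M.IsBinaryM)
    (hsimple : M.IsSimpleM) (x : α) (hx : x ∈ M.E)
    (N : Matroid α) (hN : N.IsMinorOf (M.con {x}))
    (C : Set α) (hC : N.IsCircuitSet C) (hC4 : C.ncard = 4)
    (hpar : ∀ c ∈ C, ∃ d, d ≠ c ∧ (M.con {x}).IsCircuitSet {c, d}) :
    M.HasAGMinor := by
  classical
  obtain ⟨n, φ, hφ⟩ := hbin
  have hrep : ∀ I ⊆ M.E, (M.Indep I ↔ LinearIndepOn (ZMod 2) φ I) := hφ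
  obtain ⟨K, D, rfl⟩ := hN
  change (M ／ {x} ／ K ＼ D).IsCircuitSet C at hC
  change ∀ c ∈ C, ∃ d, d ≠ c ∧ (M ／ {x}).IsCircuitSet {c, d} at hpar
  have hxi : M.Indep {x} := by simpa using hsimple x hx x hx
  have hpar' : ∀ c ∈ C, ∃ d ∈ M.E, φ d = φ c + φ x := by
    intro c hc
    obtain ⟨d, hdc, hd, -⟩ := hpar c hc
    have hE := hd.subset_ground
    have hcE : c ∈ M.E \ {x} := hE (by simp)
    have hdE : d ∈ M.E \ {x} := hE (by simp)
    have hcx : c ≠ x := hcE.2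
    have hdx : d ≠ x := hdE.2
    refine ⟨d, hdE.1, ?_⟩
    have hdep := (hxi.contract_dep_iff.1 hd).2
    have h1 : ¬ LinearIndepOn (ZMod 2) φ (({c, d, x} : Finset α) : Set α) := by
      rw [← hrep _ (by intro y; simp; rintro (rfl | rfl | rfl); exacts [hcE.1, hdE.1, hx])]
      have : (({c, d, x} : Finset α) : Set α) = {c, d} ∪ {x} := by ext; simp; tauto
      rw [this]; exact hdep.not_indep
    have key : ∀ a ∈ M.E, ∀ b ∈ M.E, LinearIndepOn (ZMod 2) φ {a, b} := fun a ha b hb =>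
      (hrep _ (by rintro y (rfl | rfl); exacts [ha, hb])).1 (hsimple a ha b hb)
    have h2 := sum_eq_zero_of_min_dep φ {c, d, x} h1 (by
      intro i hi
      simp only [Finset.mem_insert, Finset.mem_singleton] at hi
      rcases hi with rfl | rfl | rfl
      · exact (key d hdE.1 x hx).mono (by intro y; simp; tauto)
      · exact (key c hcE.1 x hx).mono (by intro y; simp; tauto)
      · exact (key c hcE.1 d hdE.1).mono (by intro y; simp; tauto))
    rw [Finset.sum_insert (by simp [hdc.symm, hcx]), Finset.sum_insert (by simp [hdx]),
      Finset.sum_singleton] at h2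
    ext i
    have h3 := congrFun h2 i
    simp only [Pi.add_apply, Pi.zero_apply] at h3 ⊢
    generalize φ c i = a at *
    generalize φ d i = b at *
    generalize φ x i = e at *
    exact zmod_two_aux a b e h3
  obtain ⟨B, hB, hxB⟩ := hxi.subset_isBasis_of_subset (X := ({x} ∪ K) ∩ M.E)
    (by rintro y rfl; exact ⟨Or.inl rfl, hx⟩)
  replace hxB : x ∈ B := hxB rfl
  rw [contract_contract, ← contract_inter_ground_eq, hB.contract_eq_contract_delete,
    delete_delete] at hC
  obtain ⟨hCd, hCi⟩ := hC
  rw [delete_dep_iff, hB.indep.contract_dep_iff] at hCd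
  obtain ⟨⟨hCB, hCdep⟩, -⟩ := hCd
  have hCi' : ∀ J, J ⊂ C → LinearIndepOn (ZMod 2) φ (B ∪ J) := by
    intro J hJ
    have h := (hB.indep.contract_indep_iff.1 (delete_indep_iff.1 (hCi J hJ)).1).2
    rw [union_comm]
    exact (hrep _ h.subset_ground).1 h
  have hBl : LinearIndepOn (ZMod 2) φ B := (hrep _ hB.indep.subset_ground).1 hB.indep
  have hCE : C ⊆ M.E := subset_union_left.trans hCdep.subset_ground
  have hCfin : C.Finite := Set.finite_of_ncard_ne_zero (by omega)
  obtain ⟨c, hcinj, hcr⟩ : ∃ c : Fin 4 → α, Function.Injective c ∧ range c = C := by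
    have := hCfin.fintype
    have hcard : Fintype.card C = 4 := by rw [← Nat.card_eq_fintype_card]; exact hC4
    let e := (Fintype.equivFinOfCardEq hcard).symm
    refine ⟨fun i => e i, Subtype.val_injective.comp e.injective, ?_⟩
    have := e.surjective.range_comp (Subtype.val : C → α)
    rw [Subtype.range_coe] at this
    exact this
  have hcC : ∀ i, c i ∈ C := fun i => hcr ▸ mem_range_self i
  set K' := B \ {x} with hK'
  have hBK : B = insert x K' := by rw [hK', insert_sdiff_singleton, insert_eq_of_mem hxB]
  have hK'i : M.Indep K' := hB.indep.subset sdiff_subset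
  have hK'l : LinearIndepOn (ZMod 2) φ K' := hBl.mono sdiff_subset
  set U := Submodule.span (ZMod 2) (φ '' K') with hU
  obtain ⟨s, hs⟩ : ∃ s : ZMod 2,
      U.mkQ (φ (c 0)) + U.mkQ (φ (c 1)) + U.mkQ (φ (c 2)) + U.mkQ (φ (c 3))
        = s • U.mkQ (φ x) := by
    have hsum := sum_eq_zero_of_min_dep
      ((Submodule.span (ZMod 2) (φ '' B)).mkQ ∘ φ) (Finset.univ.image c)
      (by
        rw [Finset.coe_image, Finset.coe_univ, image_univ, hcr, hBl.quotient_iff_union hCB.symm,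
          union_comm, ← hrep _ hCdep.subset_ground]
        exact hCdep.not_indep)
      (by
        intro i hi
        have hiC : i ∈ C := by rw [← hcr]; simpa using hi
        have hE : (((Finset.univ.image c).erase i : Finset α) : Set α) = C \ {i} := by
          rw [Finset.coe_erase, Finset.coe_image, Finset.coe_univ, image_univ, hcr]
        rw [hE, hBl.quotient_iff_union (hCB.symm.mono_right sdiff_subset)]
        exact hCi' _ (sdiff_singleton_ssubset.2 hiC))
    rw [Finset.sum_image hcinj.injOn, Fin.sum_univ_four] at hsum
    simp only [Function.comp_apply, ← map_add] at hsum
    rw [Submodule.mkQ_apply, Submodule.Quotient.mk_eq_zero, hBK, image_insert_eq,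
      Submodule.mem_span_insert] at hsum
    obtain ⟨a, z, hz, h⟩ := hsum
    refine ⟨a, ?_⟩
    simp only [← map_add, ← map_smul]
    rw [h, map_add, (Submodule.Quotient.mk_eq_zero U).2 hz |> (Submodule.mkQ_apply U z).trans,
      add_zero]
  have hli : ∀ a : Fin 4 → ZMod 2, a 0 • U.mkQ (φ (c 0)) + a 1 • U.mkQ (φ (c 1)) +
      a 2 • U.mkQ (φ (c 2)) + a 3 • U.mkQ (φ x) = 0 → a = 0 := by
    intro a ha
    have hxC : ∀ i, c i ≠ x := fun i h => hCB.ne_of_mem (hcC i) hxB h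
    have hss : ({c 0, c 1, c 2} : Set α) ⊂ C := by
      refine ⟨by rintro y (rfl | rfl | rfl) <;> exact hcC _, fun h => ?_⟩
      have := h (hcC 3)
      simp [hcinj.eq_iff] at this
    have h1 := hCi' _ hss
    have hdj : Disjoint K' ({c 0, c 1, c 2, x} : Set α) := by
      rw [Set.disjoint_right]
      rintro y (rfl | rfl | rfl | rfl) hy
      · exact hCB.ne_of_mem (hcC 0) hy.1 rfl
      · exact hCB.ne_of_mem (hcC 1) hy.1 rfl
      · exact hCB.ne_of_mem (hcC 2) hy.1 rfl
      · exact hy.2 rfl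
    have h2 : LinearIndepOn (ZMod 2) (U.mkQ ∘ φ) {c 0, c 1, c 2, x} := by
      rw [hK'l.quotient_iff_union hdj]
      refine h1.mono ?_
      rw [hBK]; intro y; simp only [mem_union, mem_insert_iff, mem_singleton_iff]; tauto
    have hinj : Function.Injective ![c 0, c 1, c 2, x] := by
      intro i j h
      have h' : ∀ i, x ≠ c i := fun i => (hxC i).symm
      fin_cases i <;> fin_cases j <;> simp [hcinj.eq_iff, h', hxC] at h ⊢
    have h3 : LinearIndependent (ZMod 2) ((U.mkQ ∘ φ) ∘ ![c 0, c 1, c 2, x]) := by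
      have hr : range ![c 0, c 1, c 2, x] = {c 0, c 1, c 2, x} := by
        ext y
        simp only [Matrix.range_cons, Matrix.range_empty, mem_union, mem_insert_iff,
          mem_singleton_iff, union_empty]
      rw [← hr] at h2
      exact (linearIndepOn_range_iff hinj _).1 h2
    funext i
    refine Fintype.linearIndependent_iff.1 h3 a ?_ i
    rw [Fin.sum_univ_four]
    simpa using ha
  obtain ⟨P, hP, hPv⟩ := cubeVec_repr (fun i => U.mkQ (φ (c i))) (U.mkQ (φ x)) s hli hs
  choose d hdE hd using fun i => hpar' (c i) (hcC i)
  let e : Fin 4 × ZMod 2 → α := fun p => if p.2 = 0 then c p.1 else d p.1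
  have heE : ∀ p, e p ∈ M.E := by
    intro p; simp only [e]; split_ifs
    exacts [hCE (hcC _), hdE _]
  have heP : ∀ p, U.mkQ (φ (e p)) = P (cubeVec s p) := by
    intro p; rw [hPv]; simp only [e]; split_ifs with h
    · rw [h, zero_smul, add_zero]
    · have h2 : ∀ a : ZMod 2, a ≠ 0 → a = 1 := by decide
      rw [h2 _ h, one_smul, hd, map_add]
  have heK : ∀ p, e p ∉ K' := by
    intro p hp
    have h0 : U.mkQ (φ (e p)) = 0 := by
      rw [Submodule.mkQ_apply, Submodule.Quotient.mk_eq_zero]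
      exact Submodule.subset_span (mem_image_of_mem _ hp)
    rw [heP, map_eq_zero_iff P hP] at h0
    have := cubeVec_mem s p
    rw [h0] at this
    simp at this
  let ψ : α → Fin 4 → ZMod 2 := fun y => Function.invFun P (U.mkQ (φ y))
  have hψ : ∀ p, ψ (e p) = cubeVec s p := fun p => by
    simp only [ψ]; rw [heP]; exact Function.leftInverse_invFun hP _
  have hground : (M ／ K' ＼ (M.E \ range e)).E = range e := by
    rw [delete_ground, contract_ground]
    ext y
    constructor
    · rintro ⟨⟨h1, h2⟩, h3⟩
      by_contra h
      exact h3 ⟨h1, h⟩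
    · rintro ⟨p, rfl⟩
      exact ⟨⟨heE p, heK p⟩, fun h => h.2 (mem_range_self p)⟩
  refine ⟨M ／ K' ＼ (M.E \ range e), ⟨K', M.E \ range e, rfl⟩, ψ, ?_, ?_⟩
  · intro I hI
    rw [hground] at hI
    have hdj : Disjoint K' I := by
      rw [Set.disjoint_right]
      intro y hy
      obtain ⟨p, rfl⟩ := hI hy
      exact heK p
    have hIE : I ⊆ M.E := by
      intro y hy
      obtain ⟨p, rfl⟩ := hI hy
      exact heE p
    have hdj2 : Disjoint I (M.E \ range e) := by
      rw [Set.disjoint_left]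
      exact fun y hy h => h.2 (hI hy)
    rw [delete_indep_iff, and_iff_left hdj2, hK'i.contract_indep_iff, and_iff_right hdj.symm,
      hrep _ (union_subset hIE hK'i.subset_ground), union_comm, ← hK'l.quotient_iff_union hdj,
      ← P.linearIndependent_iff (LinearMap.ker_eq_bot.2 hP)]
    have : P ∘ I.restrict ψ = I.restrict (U.mkQ ∘ φ) := by
      funext ⟨y, hy⟩
      obtain ⟨p, rfl⟩ := hI hy
      change P (ψ (e p)) = U.mkQ (φ (e p))
      rw [hψ, heP]
    rw [this]
    rfl
  · rw [hground]
    refine ⟨?_, ?_, ?_⟩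
    · rintro _ ⟨p, rfl⟩
      rw [hψ]; exact cubeVec_mem s p
    · rintro _ ⟨p, rfl⟩ _ ⟨p', rfl⟩ h
      rw [hψ, hψ] at h
      rw [cubeVec_inj s h]
    · intro y hy
      obtain ⟨p, rfl⟩ := cubeVec_surj s y hy
      exact ⟨e p, mem_range_self p, hψ p⟩
end

section
/- Let M be a simple binary matroid containing two distinct F7-restrictions R1 ≠ R2 such that the rank of R1 ∪ R2 in M equals 4. Then M has a restriction isomorphic to AG(3,2); indeed, the restriction of M to (R1 ∪ R2) ∖ (R1 ∩ R2) is isomorphic to AG(3,2). -/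
open Matroid Set

variable {α : Type*}

open Module in
lemma aux_ncard {n : ℕ} {φ : α → (Fin n → ZMod 2)} {I : Set α}
    (h : LinearIndepOn (ZMod 2) φ I) :
    I.ncard = finrank (ZMod 2) (Submodule.span (ZMod 2) (φ '' I)) := by
  have hfin : Finite I := LinearIndependent.finite h
  have := Fintype.ofFinite I
  have h2 := finrank_span_eq_card (R := ZMod 2) (b := fun x : I => φ x) h
  rw [image_eq_range, h2, ← Nat.card_eq_fintype_card, Nat.card_coe_set_eq]

lemma aux_zmod (x : ZMod 2) : x = 0 ∨ x = 1 := by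
  revert x; decide

lemma aux_triple {W : Type*} [AddCommGroup W] [Module (ZMod 2) W] {φ : α → W} {a b c : α}
    (hab : a ≠ b) (hac : a ≠ c) (hbc : LinearIndepOn (ZMod 2) φ {b, c})
    (h0 : φ a ≠ 0) (h1 : φ a ≠ φ b) (h2 : φ a ≠ φ c)
    (h : ¬ LinearIndepOn (ZMod 2) φ {a, b, c}) : φ a = φ b + φ c := by
  rw [linearIndepOn_insert (by simp [hab, hac])] at h
  have h3 : φ a ∈ Submodule.span (ZMod 2) (φ '' {b, c}) := by
    by_contra h4; exact h ⟨hbc, h4⟩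
  rw [image_pair, Submodule.mem_span_pair] at h3
  obtain ⟨x, y, hxy⟩ := h3
  rcases aux_zmod x with rfl | rfl <;> rcases aux_zmod y with rfl | rfl <;> simp at hxy
  · exact absurd hxy.symm h0
  · exact absurd hxy.symm h2
  · exact absurd hxy.symm h1
  · exact hxy.symm

open Module in
lemma aux_plane (M : Matroid α) {n : ℕ} {φ : α → (Fin n → ZMod 2)}
    (hφ : M.IsRepBy (ZMod 2) φ) (hsimple : M.IsSimpleM) (hinj : InjOn φ M.E)
    (h0 : ∀ x ∈ M.E, φ x ≠ 0)
    (R : Set α) (hR : R ⊆ M.E) (hF : (M ↾ R).IsBinaryIsoTo fanoVecs) :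
    ∃ P : Submodule (ZMod 2) (Fin n → ZMod 2), finrank (ZMod 2) P = 3 ∧
      Submodule.span (ZMod 2) (φ '' R) = P ∧
      ∀ v, v ∈ P ↔ v = 0 ∨ v ∈ φ '' R := by
  obtain ⟨ψ, hψ, hbij⟩ := hF
  simp only [restrict_ground_eq] at hbij
  have hrep : ∀ I ⊆ R, (LinearIndepOn (ZMod 2) φ I ↔ LinearIndepOn (ZMod 2) ψ I) := by
    intro I hI
    have h1 := hψ I hI
    have h2 := hφ I (hI.trans hR)
    rw [restrict_indep_iff] at h1
    constructor
    · intro h; exact h1.1 ⟨h2.2 h, hI⟩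
    · intro h; exact h2.1 (h1.2 h).1
  have hadd : ∀ b ∈ R, ∀ c ∈ R, b ≠ c → ∃ a ∈ R, φ a = φ b + φ c := by
    intro b hb c hc hbc
    have hψbc : ψ b ≠ ψ c := fun h => hbc (hbij.injOn hb hc h)
    have hb0 : ψ b ≠ 0 := hbij.mapsTo hb
    have hc0 : ψ c ≠ 0 := hbij.mapsTo hc
    have hne : ψ b + ψ c ≠ 0 := by
      intro h
      rw [← ZModModule.sub_eq_add, sub_eq_zero] at h
      exact hψbc h
    obtain ⟨a, ha, hae⟩ := hbij.surjOn (show ψ b + ψ c ∈ fanoVecs from hne)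
    have hab : a ≠ b := by
      rintro rfl
      simp at hae
      exact hc0 hae
    have hac : a ≠ c := by
      rintro rfl
      simp at hae
      exact hb0 hae
    refine ⟨a, ha, aux_triple hab hac ?_ (h0 a (hR ha)) ?_ ?_ ?_⟩
    · exact (hφ _ (pair_subset (hR hb) (hR hc))).1 (hsimple b (hR hb) c (hR hc))
    · exact fun h => hab (hinj (hR ha) (hR hb) h)
    · exact fun h => hac (hinj (hR ha) (hR hc) h)
    · rw [hrep _ (by intro x; simp; rintro (rfl | rfl | rfl) <;> assumption)]
      rw [linearIndepOn_insert (by simp [hab, hac])]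
      rintro ⟨-, h⟩
      apply h
      rw [hae, image_pair]
      exact Submodule.add_mem _ (Submodule.subset_span (by simp)) (Submodule.subset_span (by simp))
  let P : Submodule (ZMod 2) (Fin n → ZMod 2) :=
    { carrier := insert 0 (φ '' R)
      zero_mem' := by simp
      add_mem' := by
        rintro x y (rfl | ⟨b, hb, rfl⟩) (rfl | ⟨c, hc, rfl⟩)
        · simp
        · right; exact ⟨c, hc, by simp⟩
        · right; exact ⟨b, hb, by simp⟩
        · by_cases hbc : b = c
          · subst hbc; left; exact ZModModule.add_self _
          · right
            obtain ⟨a, ha, h⟩ := hadd b hb c hc hbc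
            exact ⟨a, ha, h⟩
      smul_mem' := by
        intro c x hx
        rcases aux_zmod c with rfl | rfl
        · simp
        · simpa using hx }
  have hPmem : ∀ v, v ∈ P ↔ v = 0 ∨ v ∈ φ '' R := fun v => Iff.rfl
  refine ⟨P, ?_, ?_, hPmem⟩
  · have hcard : Nat.card P = 8 := by
      change Nat.card (insert 0 (φ '' R) : Set _) = 8
      have hz : (0 : Fin n → ZMod 2) ∉ φ '' R := by
        rintro ⟨x, hx, h⟩; exact h0 x (hR hx) h
      have h7 : R.ncard = 7 := by
        rw [← ncard_image_of_injOn hbij.injOn, hbij.image_eq]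
        rw [← Nat.card_coe_set_eq, fanoVecs]
        rw [Nat.card_eq_fintype_card]
        decide
      rw [Nat.card_coe_set_eq, ncard_insert_of_notMem hz (Set.toFinite _),
        ncard_image_of_injOn (hinj.mono hR), h7]
    have h2 := Module.natCard_eq_pow_finrank (K := ZMod 2) (V := P)
    rw [hcard, Nat.card_zmod] at h2
    exact (Nat.pow_right_injective (le_refl 2) (by simpa using h2)).symm
  · apply le_antisymm
    · rw [Submodule.span_le]
      intro x hx; exact Or.inr hx
    · rintro x (rfl | hx)
      · exact zero_mem _
      · exact Submodule.subset_span hx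

open Module in
lemma aux_functional {V : Type*} [AddCommGroup V] [Module (ZMod 2) V] [FiniteDimensional (ZMod 2) V]
    (hV : finrank (ZMod 2) V = 4) (P : Submodule (ZMod 2) V) (hP : finrank (ZMod 2) P = 3) :
    ∃ f : V →ₗ[ZMod 2] ZMod 2, ∀ v, v ∈ P ↔ f v = 0 := by
  have hlt : P < ⊤ := by
    rw [lt_top_iff_ne_top]; rintro rfl
    rw [finrank_top] at hP; omega
  obtain ⟨f, hf, hle⟩ := Submodule.exists_le_ker_of_lt_top P hlt
  have h1 := Module.Dual.finrank_ker_add_one_of_ne_zero (f := f) hf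
  have : P = LinearMap.ker f := Submodule.eq_of_le_of_finrank_eq hle (by omega)
  refine ⟨f, fun v => ?_⟩
  rw [this, LinearMap.mem_ker]

open Module in
lemma aux_equiv {V : Type*} [AddCommGroup V] [Module (ZMod 2) V] [FiniteDimensional (ZMod 2) V]
    (hV : finrank (ZMod 2) V = 4) (f : V →ₗ[ZMod 2] ZMod 2) (hf : f ≠ 0) :
    ∃ e : V ≃ₗ[ZMod 2] (Fin 4 → ZMod 2), ∀ v, e v 0 = f v := by
  have h1 := Module.Dual.finrank_ker_add_one_of_ne_zero (f := f) hf
  have h3 : finrank (ZMod 2) (LinearMap.ker f) = 3 := by omega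
  obtain ⟨u, hu⟩ : ∃ u, f u = 1 := by
    by_contra! h
    apply hf
    ext v
    rcases aux_zmod (f v) with h' | h'
    · simpa using h'
    · exact absurd h' (h v)
  let b := finBasisOfFinrankEq (ZMod 2) (LinearMap.ker f) h3
  let B : Basis (Fin 4) (ZMod 2) V := Basis.mkFinCons u b
    (by
      intro c x hx h
      have := congrArg f h
      rw [LinearMap.mem_ker] at hx
      simpa [hx, hu] using this)
    (by
      intro z
      refine ⟨f z, ?_⟩
      simp [hu, ZModModule.add_self])
  have hB : ⇑B = Fin.cons u ((↑) ∘ b) := Basis.coe_mkFinCons _ _ _ _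
  refine ⟨B.equivFun, fun v => ?_⟩
  conv_rhs => rw [← B.sum_equivFun v]
  rw [map_sum, Fin.sum_univ_succ]
  simp only [hB, map_smul, Fin.cons_zero, hu, Fin.cons_succ, Function.comp,
    (LinearMap.mem_ker.1 (b _).2)]
  simp

theorem two_F7_rank_four {α : Type*} (M : Matroid α) (hbin : M.IsBinaryM)
    (hsimple : M.IsSimpleM) (R₁ R₂ : Set α)
    (hR₁ : R₁ ⊆ M.E) (hR₂ : R₂ ⊆ M.E) (hne : R₁ ≠ R₂)
    (hF₁ : (M ↾ R₁).IsBinaryIsoTo fanoVecs) (hF₂ : (M ↾ R₂).IsBinaryIsoTo fanoVecs)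
    (hrank : M.rks (R₁ ∪ R₂) = 4) :
    (∃ R ⊆ M.E, (M ↾ R).IsBinaryIsoTo agVecs) ∧
      (M ↾ ((R₁ ∪ R₂) \ (R₁ ∩ R₂))).IsBinaryIsoTo agVecs := by
  obtain ⟨n, φ, hφ⟩ := hbin
  have hinj : InjOn φ M.E := by
    intro x hx y hy h
    have h1 : LinearIndepOn (ZMod 2) φ {x, y} :=
      (hφ _ (pair_subset hx hy)).1 (hsimple x hx y hy)
    exact h1.injOn (by simp) (by simp) h
  have h0 : ∀ x ∈ M.E, φ x ≠ 0 := by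
    intro x hx
    have h1 : LinearIndepOn (ZMod 2) φ {x, x} :=
      (hφ _ (pair_subset hx hx)).1 (hsimple x hx x hx)
    exact h1.ne_zero (by simp)
  obtain ⟨P₁, hd₁, hs₁, hm₁⟩ := aux_plane M hφ hsimple hinj h0 R₁ hR₁ hF₁
  obtain ⟨P₂, hd₂, hs₂, hm₂⟩ := aux_plane M hφ hsimple hinj h0 R₂ hR₂ hF₂
  have hmem : ∀ (R : Set α) (P : Submodule (ZMod 2) (Fin n → ZMod 2)), R ⊆ M.E →
      (∀ v, v ∈ P ↔ v = 0 ∨ v ∈ φ '' R) → ∀ x ∈ M.E, (φ x ∈ P ↔ x ∈ R) := by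
    intro R P hR hm x hx
    rw [hm]
    constructor
    · rintro (h | ⟨y, hy, h⟩)
      · exact absurd h (h0 x hx)
      · rwa [← hinj (hR hy) hx h]
    · intro h; exact Or.inr ⟨x, h, rfl⟩
  have hx₁ := hmem R₁ P₁ hR₁ hm₁
  have hx₂ := hmem R₂ P₂ hR₂ hm₂
  have hU : R₁ ∪ R₂ ⊆ M.E := union_subset hR₁ hR₂
  set Q := P₁ ⊔ P₂ with hQ
  have hspan : Submodule.span (ZMod 2) (φ '' (R₁ ∪ R₂)) = Q := by
    rw [image_union, Submodule.span_union, hs₁, hs₂]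
  have hQ4 : Module.finrank (ZMod 2) Q = 4 := by
    have hle : ∀ I ⊆ R₁ ∪ R₂, M.Indep I → I.ncard ≤ Module.finrank (ZMod 2) Q := by
      intro I hI hind
      rw [aux_ncard ((hφ I (hI.trans hU)).1 hind), ← hspan]
      exact Submodule.finrank_mono (Submodule.span_mono (image_mono hI))
    have hbdd : BddAbove {k : ℕ | ∃ I ⊆ R₁ ∪ R₂, M.Indep I ∧ I.ncard = k} := by
      refine ⟨Module.finrank (ZMod 2) Q, ?_⟩
      rintro k ⟨I, hI, hind, rfl⟩
      exact hle I hI hind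
    unfold Matroid.rks at hrank
    apply le_antisymm
    · obtain ⟨b, hbt, -, hsp, hli⟩ := exists_linearIndepOn_extension
        (K := ZMod 2) (v := φ) (linearIndepOn_empty (ZMod 2) φ) (empty_subset (R₁ ∪ R₂))
      rw [← hrank]
      apply le_csSup hbdd
      refine ⟨b, hbt, (hφ b (hbt.trans hU)).2 hli, ?_⟩
      have hbs : Submodule.span (ZMod 2) (φ '' b) = Q := by
        rw [← hspan]
        exact le_antisymm (Submodule.span_mono (image_mono hbt)) (Submodule.span_le.2 hsp)
      rw [aux_ncard hli, hbs]
    · have h4 := Nat.sSup_mem (s := {k : ℕ | ∃ I ⊆ R₁ ∪ R₂, M.Indep I ∧ I.ncard = k})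
        ⟨0, ∅, empty_subset _, M.empty_indep, by simp⟩ hbdd
      rw [hrank] at h4
      obtain ⟨I, hI, hind, h⟩ := h4
      rw [← h]; exact hle I hI hind
  have hPQ₁ : P₁ ≤ Q := le_sup_left
  have hPQ₂ : P₂ ≤ Q := le_sup_right
  obtain ⟨f₁, hf₁⟩ := aux_functional hQ4 (P₁.comap Q.subtype)
    (by rw [(Submodule.comapSubtypeEquivOfLe hPQ₁).finrank_eq, hd₁])
  obtain ⟨f₂, hf₂⟩ := aux_functional hQ4 (P₂.comap Q.subtype)
    (by rw [(Submodule.comapSubtypeEquivOfLe hPQ₂).finrank_eq, hd₂])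
  have hf : f₁ + f₂ ≠ 0 := by
    intro h
    apply hne
    have heq : ∀ v : Q, f₁ v = f₂ v := by
      intro v
      have h2 : f₁ v + f₂ v = 0 := by simpa using congrArg (fun g => g v) h
      rw [← ZModModule.sub_eq_add, sub_eq_zero] at h2
      exact h2
    have hP : ∀ v ∈ Q, (v ∈ P₁ ↔ v ∈ P₂) := by
      intro v hv
      have a1 := hf₁ ⟨v, hv⟩
      have a2 := hf₂ ⟨v, hv⟩
      rw [heq] at a1
      exact a1.trans a2.symm
    ext x
    constructor
    · intro hx
      have h3 := (hx₁ x (hR₁ hx)).2 hx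
      exact (hx₂ x (hR₁ hx)).1 ((hP _ (hPQ₁ h3)).1 h3)
    · intro hx
      have h3 := (hx₂ x (hR₂ hx)).2 hx
      exact (hx₁ x (hR₂ hx)).1 ((hP _ (hPQ₂ h3)).2 h3)
  obtain ⟨e, he⟩ := aux_equiv hQ4 (f₁ + f₂) hf
  have key : ∀ v : Q, e v 0 = 1 ↔ ((v : Fin n → ZMod 2) ∈ P₁ ∧ (v : Fin n → ZMod 2) ∉ P₂) ∨
      ((v : Fin n → ZMod 2) ∈ P₂ ∧ (v : Fin n → ZMod 2) ∉ P₁) := by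
    intro v
    have a1 : (v : Fin n → ZMod 2) ∈ P₁ ↔ f₁ v = 0 := hf₁ v
    have a2 : (v : Fin n → ZMod 2) ∈ P₂ ↔ f₂ v = 0 := hf₂ v
    rw [he, a1, a2, LinearMap.add_apply]
    generalize f₁ v = s
    generalize f₂ v = t
    revert s t
    decide
  obtain ⟨g, hg⟩ := LinearMap.exists_extend (e : Q →ₗ[ZMod 2] (Fin 4 → ZMod 2))
  have hge : ∀ v : Q, g v = e v := fun v => by
    simpa using congrArg (fun k => k v) hg
  have hginj : InjOn g (Q : Set (Fin n → ZMod 2)) := by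
    intro x hx y hy h
    have := e.injective ((hge ⟨x, hx⟩).symm.trans (h.trans (hge ⟨y, hy⟩)))
    simpa using this
  have hS : (R₁ ∪ R₂) \ (R₁ ∩ R₂) ⊆ M.E := diff_subset.trans hU
  have hUQ : ∀ x ∈ R₁ ∪ R₂, φ x ∈ Q := by
    intro x hx
    rw [← hspan]
    exact Submodule.subset_span ⟨x, hx, rfl⟩
  have main : (M ↾ ((R₁ ∪ R₂) \ (R₁ ∩ R₂))).IsBinaryIsoTo agVecs := by
    refine ⟨g ∘ φ, ?_, ?_, ?_, ?_⟩
    · intro I hI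
      rw [restrict_ground_eq] at hI
      have h1 : LinearIndepOn (ZMod 2) (g ∘ φ) I ↔ LinearIndepOn (ZMod 2) φ I := by
        apply g.linearIndepOn_iff_of_injOn
        apply hginj.mono
        rw [← hspan]
        exact Submodule.span_mono (image_mono (hI.trans diff_subset))
      rw [restrict_indep_iff]
      have h2 := hφ I (hI.trans hS)
      constructor
      · rintro ⟨h, -⟩; exact h1.2 (h2.1 h)
      · intro h; exact ⟨h2.2 (h1.1 h), hI⟩
    · rintro x hx
      rw [restrict_ground_eq] at hx
      have hxQ := hUQ x hx.1
      change g (φ x) 0 = 1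
      rw [hge ⟨φ x, hxQ⟩, key]
      simp only [hx₁ x (hS hx), hx₂ x (hS hx)]
      obtain ⟨h1 | h1, h2⟩ := hx
      · exact Or.inl ⟨h1, fun h => h2 ⟨h1, h⟩⟩
      · exact Or.inr ⟨h1, fun h => h2 ⟨h, h1⟩⟩
    · intro x hx y hy h
      rw [restrict_ground_eq] at hx hy
      exact hinj (hS hx) (hS hy) (hginj (hUQ x hx.1) (hUQ y hy.1) h)
    · intro y hy
      rw [restrict_ground_eq]
      have h1 := (key (e.symm y)).1 (by rw [e.apply_symm_apply]; exact hy)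
      have hfin : ∀ x, φ x = (e.symm y : Fin n → ZMod 2) → (g ∘ φ) x = y := by
        intro x hx
        simp only [Function.comp, hx, hge, e.apply_symm_apply]
      rcases h1 with ⟨ha, hb⟩ | ⟨ha, hb⟩
      · rcases (hm₁ _).1 ha with h | ⟨x, hx, h⟩
        · rw [h] at hb; exact absurd (zero_mem _) hb
        · refine ⟨x, ⟨Or.inl hx, fun h' => hb ?_⟩, hfin x h⟩
          rw [← h]; exact (hx₂ x (hR₁ hx)).2 h'.2
      · rcases (hm₂ _).1 ha with h | ⟨x, hx, h⟩
        · rw [h] at hb; exact absurd (zero_mem _) hb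
        · refine ⟨x, ⟨Or.inr hx, fun h' => hb ?_⟩, hfin x h⟩
          rw [← h]; exact (hx₁ x (hR₂ hx)).2 h'.1
  exact ⟨⟨_, hS, main⟩, main⟩
end
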